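/- arXiv:1503.03604 — 2 statements merged into one kernel-verified Lean document; each statement's English description precedes it below -/
import Mathlib

section
/- Let p₁ and p₂ be distinct primes with p₁ ≡ p₂ ≡ 1 (mod 4) such that the Legendre symbols satisfy (2/p₁) = (2/p₂) = (p₁/p₂) = −1. Then ε₂·ε_{p₁p₂}·ε_{2p₁p₂} is a square in the field ℚ(√2, √(p₁p₂)) if and only if (p₁p₂/2)₄·(2p₁/p₂)₄·(2p₂/p₁)₄ = −1. -/
open NumberField IntermediateField

/-- `ε` is the fundamental unit of the real quadratic field `ℚ(√D)` (for `D > 1` squarefree):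
elements of the ring of integers of `ℚ(√D)` are exactly the numbers `(x + y√D)/2` with
`x ≡ y·D (mod 2)`, and units are those with `x² - Dy² = ±4`.  The fundamental unit is the
least unit `> 1`; equivalently, every unit is of the form `±ε^k` with `k ∈ ℤ`. -/
def IsFundUnit (D : ℕ) (ε : ℝ) : Prop :=
  1 < ε ∧
  (∃ x y : ℤ, ε = ((x : ℝ) + (y : ℝ) * Real.sqrt D) / 2 ∧
    (x ^ 2 - (D : ℤ) * y ^ 2 = 4 ∨ x ^ 2 - (D : ℤ) * y ^ 2 = -4)) ∧
  ∀ x y : ℤ, (x ^ 2 - (D : ℤ) * y ^ 2 = 4 ∨ x ^ 2 - (D : ℤ) * y ^ 2 = -4) →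
    1 < ((x : ℝ) + (y : ℝ) * Real.sqrt D) / 2 →
    ε ≤ ((x : ℝ) + (y : ℝ) * Real.sqrt D) / 2

open scoped NumberTheorySymbols

lemma Int.exists_sq_eq_of_odd {n : ℤ} (h : Odd n) : ∃ k, n ^ 2 = 8 * k + 1 := by
  obtain ⟨m, rfl⟩ := h
  obtain ⟨k, hk⟩ := Int.even_mul_succ_self m
  exact ⟨k, by linear_combination 4 * hk⟩

lemma jacobiSym_eq_one_of_mul_sq {m k t : ℤ} {n : ℕ} (h : (n : ℤ) ∣ m * k ^ 2 - t ^ 2)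
    (hk : IsCoprime k n) (ht : IsCoprime t n) : J(m | n) = 1 := by
  have h1 : J(m * k ^ 2 | n) = J(t ^ 2 | n) :=
    jacobiSym.mod_left' (Int.emod_eq_emod_iff_emod_sub_eq_zero.2 (Int.emod_eq_zero_of_dvd h))
  rwa [jacobiSym.mul_left, jacobiSym.sq_one' (Int.isCoprime_iff_gcd_eq_one.1 hk),
    jacobiSym.sq_one' (Int.isCoprime_iff_gcd_eq_one.1 ht), mul_one] at h1

lemma jacobiSym_natAbs {p : ℕ} (hp : p % 4 = 1) (n : ℤ) : J((n.natAbs : ℤ) | p) = J(n | p) := by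
  rcases Int.natAbs_eq n with h | h
  · rw [← h]
  · conv_rhs => rw [h]
    rw [jacobiSym.neg _ (Nat.odd_iff.2 (by omega)), ZMod.χ₄_nat_one_mod_four hp, one_mul]

lemma jacobiSym_flip {p : ℕ} (hp : p % 4 = 1) {n : ℤ} (hn : Odd n) :
    J(n | p) = J(p | n.natAbs) := by
  rw [← jacobiSym_natAbs hp,
    jacobiSym.quadratic_reciprocity_one_mod_four' (Int.natAbs_odd.2 hn) hp]

lemma jacobiSym_two_of_five {p : ℕ} (hp : p % 8 = 5) : J(2 | p) = -1 := by
  rw [jacobiSym.at_two (Nat.odd_iff.2 (by omega)), ZMod.χ₈_nat_eq_if_mod_eight]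
  simp [hp]; omega

lemma jacobiSym_eq_one_of_forall_prime {a : ℤ} {n : ℕ} (hn : n ≠ 0)
    (h : ∀ l : ℕ, l.Prime → l ∣ n → J(a | l) = 1) : J(a | n) = 1 := by
  induction n using Nat.recOnMul with
  | zero => exact absurd rfl hn
  | one => exact jacobiSym.one_right a
  | prime l hl => exact h l hl dvd_rfl
  | mul x y hx hy =>
    have hx0 : x ≠ 0 := by rintro rfl; simp at hn
    have hy0 : y ≠ 0 := by rintro rfl; simp at hn
    rw [jacobiSym.mul_right' a hx0 hy0, hx hx0 fun l hl hd => h l hl (hd.mul_right y),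
      hy hy0 fun l hl hd => h l hl (hd.mul_left x), one_mul]

lemma isCoprime_of_not_dvd {p : ℕ} (hp : p.Prime) {k : ℤ} (h : ¬ (p : ℤ) ∣ k) :
    IsCoprime k p :=
  ((Nat.prime_iff_prime_int.1 hp).coprime_iff_not_dvd.2 h).symm

/-- A prime `p ≡ 5 (mod 8)` with `N² p = α² + β²`. -/
lemma jacobiSym_of_sum_sq {p : ℕ} (hp : p % 8 = 5) {N α β : ℤ} (hN : Odd N)
    (h : N ^ 2 * p = α ^ 2 + β ^ 2) (hc : IsCoprime α β) :
    J(β | p) = if Even β then -1 else 1 := by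
  have key : ∀ γ : ℤ, Odd γ → γ ∣ β → J(γ | p) = 1 := by
    rintro γ hγ ⟨δ, rfl⟩
    rw [jacobiSym_flip (by omega) hγ]
    have hα : IsCoprime α γ := hc.of_mul_right_left
    have hNγ : IsCoprime N γ := by
      have h1 : IsCoprime (α ^ 2 + γ * (γ * δ ^ 2)) γ :=
        IsCoprime.add_mul_left_left hα.pow_left _
      rw [show α ^ 2 + γ * (γ * δ ^ 2) = N * (N * p) by linear_combination -h] at h1
      exact h1.of_mul_left_left
    have hab : ∀ {z : ℤ}, IsCoprime z γ → IsCoprime z (γ.natAbs : ℤ) := fun hz => by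
      rw [Int.isCoprime_iff_gcd_eq_one] at hz ⊢
      simpa [Int.gcd, Int.natAbs_abs] using hz
    refine jacobiSym_eq_one_of_mul_sq (k := N) (t := α) ?_ (hab hNγ) (hab hα)
    rw [Int.natCast_natAbs, abs_dvd]
    exact ⟨γ * δ ^ 2, by linear_combination h⟩
  split_ifs with hβ
  · obtain ⟨γ, rfl⟩ := even_iff_two_dvd.1 hβ
    have hγ : Odd γ := by
      by_contra hγ
      obtain ⟨δ, rfl⟩ := even_iff_two_dvd.1 (Int.not_odd_iff_even.1 hγ)
      have hα : Odd α := by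
        by_contra hα
        obtain ⟨ε, rfl⟩ := even_iff_two_dvd.1 (Int.not_odd_iff_even.1 hα)
        exact absurd (hc.isUnit_of_dvd' (dvd_mul_right _ _) (dvd_mul_right _ _)) (by decide)
      obtain ⟨k, hk⟩ := Int.exists_sq_eq_of_odd hα
      obtain ⟨l, hl⟩ := Int.exists_sq_eq_of_odd hN
      have h5 : (p : ℤ) = 8 * ((p / 8 : ℕ) : ℤ) + 5 := by omega
      generalize ((p / 8 : ℕ) : ℤ) = P at h5
      rw [hl, hk, h5] at h
      ring_nf at h
      omega
    rw [jacobiSym.mul_left, key γ hγ (dvd_mul_left _ _), jacobiSym_two_of_five hp]; rfl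
  · exact key β (Int.not_even_iff_odd.1 hβ) dvd_rfl

/-- If `n n' = α s² + t²` and the primes dividing both `n` and `n'` see `-α` as a square,
then `-α` has trivial Jacobi symbol modulo `n`. -/
lemma jacobiSym_neg_eq_one_of_mul_eq {α s t n' : ℤ} {n : ℕ} (hn : n ≠ 0) (hn' : n' ≠ 0)
    (h : n * n' = α * s ^ 2 + t ^ 2) (hα : IsCoprime α n)
    (hcom : ∀ l : ℕ, l.Prime → l ∣ n → (l : ℤ) ∣ n' → J(-α | l) = 1) : J(-α | n) = 1 := by
  obtain ⟨k, w, rfl, hk⟩ := Nat.sq_mul_squarefree n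
  have hw0 : w ≠ 0 := by rintro rfl; simp at hn
  have hk0 : k ≠ 0 := hk.ne_zero
  have hαw : IsCoprime (-α) w := by
    push_cast at hα
    exact ((hα.of_mul_right_left).of_isCoprime_of_dvd_right (dvd_pow_self _ two_ne_zero)).neg_left
  rw [jacobiSym.mul_right' _ (pow_ne_zero 2 hw0) hk0, jacobiSym.pow_right,
    jacobiSym.sq_one (Int.isCoprime_iff_gcd_eq_one.1 hαw), one_mul]
  refine jacobiSym_eq_one_of_forall_prime hk0 fun l hl hlk => ?_
  by_cases hln : (l : ℤ) ∣ n'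
  · exact hcom l hl (hlk.mul_left _) hln
  have hlp : Prime (l : ℤ) := Nat.prime_iff_prime_int.1 hl
  have hlα : ¬ (l : ℤ) ∣ α := fun hd => hlp.not_isUnit (hα.isUnit_of_dvd' hd
    (by exact_mod_cast hlk.mul_left (w ^ 2)))
  obtain ⟨g, s₁, t₁, hg, hcop, rfl, rfl⟩ : ∃ g s₁ t₁ : ℤ, g ≠ 0 ∧ IsCoprime s₁ t₁ ∧ s = g * s₁ ∧
      t = g * t₁ := by
    have hst : 0 < s.gcd t := by
      refine Nat.pos_of_ne_zero fun h0 => ?_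
      obtain ⟨rfl, rfl⟩ := Int.gcd_eq_zero_iff.1 h0
      have h6 : ((w ^ 2 * k : ℕ) : ℤ) * n' = 0 := by rw [h]; ring
      rcases mul_eq_zero.1 h6 with h6 | h6
      · exact hn (by exact_mod_cast h6)
      · exact hn' h6
    obtain ⟨s₁, t₁, hc, h1, h2⟩ := Int.exists_gcd_one hst
    exact ⟨s.gcd t, s₁, t₁, by exact_mod_cast hst.ne', Int.isCoprime_iff_gcd_eq_one.2 hc,
      by linear_combination h1, by linear_combination h2⟩
  set M := α * s₁ ^ 2 + t₁ ^ 2 with hM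
  have hlM : (l : ℤ) ∣ M := by
    have h2 : g ^ 2 * (k * n' * M) = (w * (k * n')) ^ 2 := by
      rw [hM]; push_cast at h; linear_combination -(k * n') * h
    obtain ⟨e, he⟩ : g ∣ w * (k * n') := by
      rw [← Int.pow_dvd_pow_iff two_ne_zero]; exact ⟨_, h2.symm⟩
    have h3 : k * n' * M = e ^ 2 := by
      apply mul_left_cancel₀ (pow_ne_zero 2 hg)
      rw [h2, he]; ring
    obtain ⟨k', rfl⟩ := hlk
    have hlk' : ¬ (l : ℤ) ∣ k' := fun hd => hl.one_lt.ne'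
      (Nat.isUnit_iff.1 (hk l (Nat.mul_dvd_mul_left l (Int.natCast_dvd_natCast.1 hd))))
    obtain ⟨e', rfl⟩ : (l : ℤ) ∣ e := hlp.dvd_of_dvd_pow (n := 2)
      ⟨k' * n' * M, by rw [← h3]; push_cast; ring⟩
    have h4 : k' * n' * M = l * e' ^ 2 := by
      apply mul_left_cancel₀ hlp.ne_zero
      push_cast at h3; linear_combination h3
    have h5 : (l : ℤ) ∣ k' * n' * M := ⟨_, h4⟩
    exact (hlp.dvd_or_dvd h5).resolve_left fun hd => (hlp.dvd_or_dvd hd).elim hlk' hln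
  have hls : ¬ (l : ℤ) ∣ s₁ := fun hd => hlp.not_isUnit (hcop.isUnit_of_dvd' hd
    (hlp.dvd_of_dvd_pow (n := 2) ((dvd_add_right ((hd.pow two_ne_zero).mul_left α)).1 hlM)))
  have hlt : ¬ (l : ℤ) ∣ t₁ := fun hd => by
    have : (l : ℤ) ∣ α * s₁ ^ 2 := (dvd_add_left (hd.pow two_ne_zero)).1 hlM
    exact (hlp.dvd_or_dvd this).elim hlα fun h' => hls (hlp.dvd_of_dvd_pow h')
  refine jacobiSym_eq_one_of_mul_sq (k := s₁) (t := t₁) ?_ (isCoprime_of_not_dvd hl hls)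
    (isCoprime_of_not_dvd hl hlt)
  rw [show -α * s₁ ^ 2 - t₁ ^ 2 = -M by rw [hM]; ring]
  exact (dvd_neg).2 hlM

lemma exists_small_linear_solution {p₁ p₂ : ℕ} (hp₁ : p₁.Prime) (hp₂ : p₂.Prime)
    (k : ZMod p₁) (l : ZMod p₂) :
    ∃ X Y Z : ℤ, (X ≠ 0 ∨ Y ≠ 0 ∨ Z ≠ 0) ∧ X ^ 2 ≤ p₁ * p₂ ∧ Y ^ 2 ≤ 2 * p₂ ∧ Z ^ 2 ≤ 2 * p₁ ∧
      (X : ZMod p₁) = k * Z ∧ (X : ZMod p₂) = l * Y ∧ (Y : ZMod 2) = Z := by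
  have := Fact.mk hp₁
  have := Fact.mk hp₂
  set s := Nat.sqrt (p₁ * p₂)
  set t := Nat.sqrt (2 * p₂)
  set r := Nat.sqrt (2 * p₁)
  let f : Fin (s + 1) × Fin (t + 1) × Fin (r + 1) → ZMod p₁ × ZMod p₂ × ZMod 2 := fun v =>
    ((v.1 : ℕ) - k * (v.2.2 : ℕ), (v.1 : ℕ) - l * (v.2.1 : ℕ), (v.2.1 : ℕ) - (v.2.2 : ℕ))
  have hcard : Fintype.card (ZMod p₁ × ZMod p₂ × ZMod 2) <
      Fintype.card (Fin (s + 1) × Fin (t + 1) × Fin (r + 1)) := by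
    simp only [Fintype.card_prod, ZMod.card, Fintype.card_fin]
    have hs : p₁ * p₂ < (s + 1) * (s + 1) := Nat.lt_succ_sqrt _
    have ht : 2 * p₂ < (t + 1) * (t + 1) := Nat.lt_succ_sqrt _
    have hr : 2 * p₁ < (r + 1) * (r + 1) := Nat.lt_succ_sqrt _
    have := Nat.mul_lt_mul'' hs (Nat.mul_lt_mul'' ht hr)
    refine lt_of_pow_lt_pow_left₀ 2 (Nat.zero_le _) ?_
    nlinarith
  obtain ⟨v, w, hvw, hf⟩ := Fintype.exists_ne_map_eq_of_card_lt f hcard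
  simp only [f, Prod.mk.injEq] at hf
  obtain ⟨h1, h2, h3⟩ := hf
  have hb : ∀ {n : ℕ} (N : ℕ) (a b : Fin (n + 1)), n = Nat.sqrt N →
      ((a : ℤ) - (b : ℤ)) ^ 2 ≤ N := by
    intro n N a b hn
    have h1 : |(a : ℤ) - (b : ℤ)| ≤ n := by
      rw [abs_le]; constructor <;> omega
    have h2 : (n : ℤ) ^ 2 ≤ N := by
      rw [hn, sq]; exact_mod_cast Nat.sqrt_le N
    exact (sq_le_sq' (by linarith [(abs_le.1 h1).1]) (abs_le.1 h1).2).trans h2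
  refine ⟨v.1 - w.1, v.2.1 - w.2.1, v.2.2 - w.2.2, ?_, by exact_mod_cast hb (p₁ * p₂) v.1 w.1 rfl,
    by exact_mod_cast hb (2 * p₂) v.2.1 w.2.1 rfl, by exact_mod_cast hb (2 * p₁) v.2.2 w.2.2 rfl,
    ?_, ?_, ?_⟩
  · by_contra! h
    apply hvw
    ext <;> omega
  · push_cast; linear_combination h1
  · push_cast; linear_combination h2
  · push_cast; linear_combination h3

lemma exists_conic_point {p₁ p₂ : ℕ} (hp₁ : p₁.Prime) (hp₂ : p₂.Prime) (hne : p₁ ≠ p₂)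
    (h2₁ : p₁ ≠ 2) (h2₂ : p₂ ≠ 2) (hs₁ : IsSquare (2 * p₂ : ZMod p₁))
    (hs₂ : IsSquare (2 * p₁ : ZMod p₂)) :
    ∃ X Y Z : ℤ, X ≠ 0 ∧ 2 * X ^ 2 = p₁ * Y ^ 2 + p₂ * Z ^ 2 := by
  have := Fact.mk hp₁
  have := Fact.mk hp₂
  have hdiv : ∀ {p : ℕ} [Fact p.Prime], p ≠ 2 → (2 : ZMod p) ≠ 0 := fun {p} _ hp => by
    intro h0
    have h0' : ((2 : ℕ) : ZMod p) = 0 := by exact_mod_cast h0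
    rw [ZMod.natCast_eq_zero_iff] at h0'
    exact hp ((Nat.prime_dvd_prime_iff_eq Fact.out Nat.prime_two).1 h0')
  have h20₁ := hdiv h2₁
  have h20₂ := hdiv h2₂
  obtain ⟨m, hm⟩ := hs₁
  obtain ⟨n, hn⟩ := hs₂
  obtain ⟨X, Y, Z, h0, hX, hY, hZ, h1, h2, h3⟩ :=
    exists_small_linear_solution hp₁ hp₂ (m / 2) (n / 2)
  set F := 2 * X ^ 2 - p₁ * Y ^ 2 - p₂ * Z ^ 2 with hF
  have hF₁ : (p₁ : ℤ) ∣ F := by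
    rw [← ZMod.intCast_zmod_eq_zero_iff_dvd, hF]
    push_cast
    rw [h1, ZMod.natCast_self]
    field_simp
    linear_combination -Z ^ 2 * hm
  have hF₂ : (p₂ : ℤ) ∣ F := by
    rw [← ZMod.intCast_zmod_eq_zero_iff_dvd, hF]
    push_cast
    rw [h2, ZMod.natCast_self]
    field_simp
    linear_combination -Y ^ 2 * hn
  have hF₃ : (2 : ℤ) ∣ F := by
    have : ((2 : ℕ) : ℤ) ∣ F := by
      rw [← ZMod.intCast_zmod_eq_zero_iff_dvd, hF]
      have o₁ : (p₁ : ZMod 2) = 1 := ZMod.natCast_eq_one_iff_odd.2 (hp₁.odd_of_ne_two h2₁)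
      have o₂ : (p₂ : ZMod 2) = 1 := ZMod.natCast_eq_one_iff_odd.2 (hp₂.odd_of_ne_two h2₂)
      push_cast
      rw [o₁, o₂, h3]
      have : (2 : ZMod 2) = 0 := rfl
      linear_combination (X ^ 2 - Z ^ 2 : ZMod 2) * this
    exact this
  have hP₁ : Prime (p₁ : ℤ) := Nat.prime_iff_prime_int.1 hp₁
  have hP₂ : Prime (p₂ : ℤ) := Nat.prime_iff_prime_int.1 hp₂
  have hc : IsCoprime (p₁ : ℤ) p₂ := by
    exact_mod_cast Nat.isCoprime_iff_coprime.2 ((Nat.coprime_primes hp₁ hp₂).2 hne)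
  have hodd : ∀ {p : ℕ}, p.Prime → p ≠ 2 → IsCoprime (2 : ℤ) p := fun {p} hp h => by
    exact_mod_cast Nat.isCoprime_iff_coprime.2 ((Nat.coprime_primes Nat.prime_two hp).2 h.symm)
  obtain ⟨e, he⟩ : (2 * (p₁ * p₂) : ℤ) ∣ F :=
    ((hodd hp₁ h2₁).mul_right (hodd hp₂ h2₂)).mul_dvd hF₃ (hc.mul_dvd hF₁ hF₂)
  have q0 : (0 : ℤ) < p₁ * p₂ := mul_pos (by exact_mod_cast hp₁.pos) (by exact_mod_cast hp₂.pos)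
  have p10 : (0 : ℤ) < p₁ := by exact_mod_cast hp₁.pos
  have p20 : (0 : ℤ) < p₂ := by exact_mod_cast hp₂.pos
  have hnsq : ∀ {p : ℕ} (W a : ℤ), p.Prime → IsCoprime a p → W ^ 2 ≠ a * p := by
    intro p W a hp hap h
    have hpp : Prime (p : ℤ) := Nat.prime_iff_prime_int.1 hp
    obtain ⟨V, rfl⟩ : (p : ℤ) ∣ W := hpp.dvd_of_dvd_pow (n := 2) ⟨a, by rw [h]; ring⟩
    refine hpp.not_isUnit (hap.symm.isUnit_of_dvd' dvd_rfl ⟨V ^ 2, ?_⟩)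
    apply mul_left_cancel₀ hpp.ne_zero
    linear_combination -h
  have hX' : X ^ 2 < p₁ * p₂ := lt_of_le_of_ne hX (hnsq X _ hp₂ hc)
  have hY' : Y ^ 2 < 2 * p₂ := lt_of_le_of_ne hY (hnsq Y _ hp₂ (hodd hp₂ h2₂))
  have he1 : e < 1 := by
    by_contra! h
    nlinarith [mul_nonneg p10.le (sq_nonneg Y), mul_nonneg p20.le (sq_nonneg Z)]
  have he2 : -2 < e := by
    by_contra! h
    nlinarith [mul_lt_mul_of_pos_left hY' p10, mul_le_mul_of_nonneg_left hZ p20.le, sq_nonneg X]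
  obtain rfl | rfl : e = 0 ∨ e = -1 := by omega
  · refine ⟨X, Y, Z, ?_, by linear_combination he⟩
    rintro rfl
    have hY0 : Y = 0 := by
      by_contra h
      nlinarith [mul_pos p10 (sq_pos_of_ne_zero h), mul_nonneg p20.le (sq_nonneg Z)]
    have hZ0 : Z = 0 := by
      by_contra h
      nlinarith [mul_pos p20 (sq_pos_of_ne_zero h), mul_nonneg p10.le (sq_nonneg Y)]
    simp [hY0, hZ0] at h0
  · exact ⟨X ^ 2 + p₁ * p₂, X * Y + p₂ * Z, X * Z - p₁ * Y, by positivity,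
      by linear_combination (X ^ 2 + p₁ * p₂) * he⟩

lemma exists_primitive_conic_point {p₁ p₂ : ℕ} (hp₁ : p₁.Prime) (hp₂ : p₂.Prime) (hne : p₁ ≠ p₂)
    (hm₁ : p₁ % 8 = 5) (hm₂ : p₂ % 8 = 5) (hs₁ : IsSquare (2 * p₂ : ZMod p₁))
    (hs₂ : IsSquare (2 * p₁ : ZMod p₂)) :
    ∃ X Y Z : ℕ, 2 * X ^ 2 = p₁ * Y ^ 2 + p₂ * Z ^ 2 ∧ Odd X ∧ Odd Y ∧ Odd Z ∧
      Nat.Coprime X Y ∧ Nat.Coprime X Z ∧ Nat.Coprime Y Z := by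
  have hex : ∃ X : ℕ, X ≠ 0 ∧ ∃ Y Z : ℕ, 2 * X ^ 2 = p₁ * Y ^ 2 + p₂ * Z ^ 2 := by
    obtain ⟨X, Y, Z, hX, h⟩ := exists_conic_point hp₁ hp₂ hne (by omega) (by omega) hs₁ hs₂
    refine ⟨X.natAbs, by simpa using hX, Y.natAbs, Z.natAbs, ?_⟩
    zify; simpa using h
  classical
  obtain ⟨hX0, Y, Z, h⟩ := Nat.find_spec hex
  have hmin := fun m => Nat.find_min (H := hex) (m := m)
  set X := Nat.find hex
  have hall : ∀ l : ℕ, l.Prime → ¬ (l ∣ X ∧ l ∣ Y ∧ l ∣ Z) := by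
    rintro l hl ⟨⟨x, hx⟩, ⟨y, rfl⟩, ⟨z, rfl⟩⟩
    have hx0 : x ≠ 0 := by rintro rfl; exact hX0 (by rw [hx, mul_zero])
    refine hmin x ?_ ⟨hx0, y, z, ?_⟩
    · rw [hx]; exact lt_mul_of_one_lt_left (Nat.pos_of_ne_zero hx0) hl.one_lt
    · rw [hx] at h
      apply Nat.eq_of_mul_eq_mul_left (pow_pos hl.pos 2)
      linarith
  have hstep : ∀ (l c W n : ℕ), l.Prime → Squarefree c → l ^ 2 ∣ c * W ^ 2 → l ∣ W := by
    intro l c W _ hl hc hd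
    by_contra hW
    have : Nat.Coprime (l ^ 2) (W ^ 2) := ((Nat.Prime.coprime_iff_not_dvd hl).2 hW).pow 2 2
    have h1 := hc l (by rw [← sq]; exact this.dvd_of_dvd_mul_right hd)
    exact hl.one_lt.ne' (Nat.isUnit_iff.1 h1)
  have hq₁ : Squarefree p₁ := hp₁.prime.squarefree
  have hq₂ : Squarefree p₂ := hp₂.prime.squarefree
  have cXY : Nat.Coprime X Y := Nat.coprime_of_dvd fun l hl h1 h2 => hall l hl ⟨h1, h2,
    hstep l p₂ Z 0 hl hq₂ ((Nat.dvd_add_right ((pow_dvd_pow_of_dvd h2 2).mul_left p₁)).1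
      (h ▸ (pow_dvd_pow_of_dvd h1 2).mul_left 2))⟩
  have cXZ : Nat.Coprime X Z := Nat.coprime_of_dvd fun l hl h1 h2 => hall l hl ⟨h1,
    hstep l p₁ Y 0 hl hq₁ ((Nat.dvd_add_left ((pow_dvd_pow_of_dvd h2 2).mul_left p₂)).1
      (h ▸ (pow_dvd_pow_of_dvd h1 2).mul_left 2)), h2⟩
  have cYZ : Nat.Coprime Y Z := Nat.coprime_of_dvd fun l hl h1 h2 => hall l hl
    ⟨hstep l 2 X 0 hl Nat.prime_two.prime.squarefree (h ▸
      dvd_add ((pow_dvd_pow_of_dvd h1 2).mul_left p₁) ((pow_dvd_pow_of_dvd h2 2).mul_left p₂)),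
      h1, h2⟩
  have o₁ : Odd p₁ := Nat.odd_iff.2 (by omega)
  have o₂ : Odd p₂ := Nat.odd_iff.2 (by omega)
  have hev : Even (p₁ * Y ^ 2 + p₂ * Z ^ 2) := h ▸ even_two_mul _
  have hYZ : Odd Y ↔ Odd Z := by
    rw [Nat.even_add'] at hev
    simpa [Nat.odd_mul, o₁, o₂, Nat.odd_pow_iff] using hev
  have oY : Odd Y := by
    by_contra hY
    have hZ := fun h => hY (hYZ.2 h)
    rw [Nat.not_odd_iff_even] at hY
    have := Nat.dvd_gcd (even_iff_two_dvd.1 hY) (even_iff_two_dvd.1 (Nat.not_odd_iff_even.1 hZ))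
    rw [cYZ] at this
    omega
  have oZ := hYZ.1 oY
  refine ⟨X, Y, Z, h, ?_, oY, oZ, cXY, cXZ, cYZ⟩
  by_contra hX
  obtain ⟨x, hx⟩ := even_iff_two_dvd.1 (Nat.not_odd_iff_even.1 hX)
  rw [hx] at h
  obtain ⟨a, ha⟩ := Int.exists_sq_eq_of_odd (n := Y) (by exact_mod_cast oY)
  obtain ⟨b, hb⟩ := Int.exists_sq_eq_of_odd (n := Z) (by exact_mod_cast oZ)
  zify at h
  rw [ha, hb] at h
  have e₁ : (p₁ : ℤ) = 8 * ((p₁ / 8 : ℕ) : ℤ) + 5 := by omega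
  have e₂ : (p₂ : ℤ) = 8 * ((p₂ / 8 : ℕ) : ℤ) + 5 := by omega
  generalize ((p₁ / 8 : ℕ) : ℤ) = P₁ at e₁
  generalize ((p₂ / 8 : ℕ) : ℤ) = P₂ at e₂
  rw [e₁, e₂] at h
  ring_nf at h
  omega

lemma jacobiSym_two_natAbs {n : ℤ} (hn : Odd n) :
    (J(2 | n.natAbs) = 1 ∧ ∃ k, n ^ 2 = 16 * k + 1) ∨
      (J(2 | n.natAbs) = -1 ∧ ∃ k, n ^ 2 = 16 * k + 9) := by
  rw [jacobiSym.at_two (Int.natAbs_odd.2 hn), ZMod.χ₈_nat_eq_if_mod_eight]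
  have h2 : n % 2 = 1 := Int.odd_iff.1 hn
  have hn8 : n = 8 * (n / 8) + n % 8 := by omega
  generalize hk : n / 8 = k at hn8
  have h8 : n % 8 = 1 ∨ n % 8 = 3 ∨ n % 8 = 5 ∨ n % 8 = 7 := by omega
  rw [if_neg (by omega)]
  rcases h8 with h | h | h | h <;> rw [h] at hn8
  · left; rw [if_pos (by omega)]; exact ⟨rfl, 4 * k ^ 2 + k, by rw [hn8]; ring⟩
  · right; rw [if_neg (by omega)]; exact ⟨rfl, 4 * k ^ 2 + 3 * k, by rw [hn8]; ring⟩
  · right; rw [if_neg (by omega)]; exact ⟨rfl, 4 * k ^ 2 + 5 * k + 1, by rw [hn8]; ring⟩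
  · left; rw [if_pos (by omega)]; exact ⟨rfl, 4 * k ^ 2 + 7 * k + 3, by rw [hn8]; ring⟩

lemma not_dvd_of_jacobiSym_ne_zero {p : ℕ} (hp : p.Prime) {a : ℤ} (h : J(a | p) ≠ 0) :
    ¬ (p : ℤ) ∣ a := by
  have : NeZero p := ⟨hp.ne_zero⟩
  intro hd
  refine h (jacobiSym.eq_zero_iff_not_coprime.2 ?_)
  exact fun h => (Nat.prime_iff_prime_int.1 hp).not_isUnit
    ((Int.isCoprime_iff_gcd_eq_one.2 h).isUnit_of_dvd' hd dvd_rfl)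

/-- A quartic residue symbol of `m` expressed through `m y² ≡ w²`. -/
lemma quartic_mul_jacobiSym {p : ℕ} (hp : p.Prime) (hm : p % 4 = 1) {m : ℕ} {y w c : ℤ}
    (hc : c = 1 ∨ c = -1) (hcong : (c : ZMod p) = (m : ZMod p) ^ ((p - 1) / 4))
    (h : (p : ℤ) ∣ m * y ^ 2 - w ^ 2) : c * J(y | p) = J(w | p) := by
  have := Fact.mk hp
  have h1 : (m : ZMod p) * (y : ZMod p) ^ 2 = (w : ZMod p) ^ 2 := by
    rw [← ZMod.intCast_zmod_eq_zero_iff_dvd] at h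
    push_cast at h
    linear_combination h
  have h2 : ((c * J(y | p) - J(w | p) : ℤ) : ZMod p) = 0 := by
    rw [← jacobiSym.legendreSym.to_jacobiSym, ← jacobiSym.legendreSym.to_jacobiSym]
    push_cast
    rw [legendreSym.eq_pow, legendreSym.eq_pow, hcong,
      show p / 2 = 2 * ((p - 1) / 4) by omega, pow_mul, pow_mul, ← mul_pow, h1, sub_self]
  rw [ZMod.intCast_zmod_eq_zero_iff_dvd] at h2
  have h3 := Int.eq_zero_of_abs_lt_dvd h2 (by
    have := hp.two_le
    have : 5 ≤ p := by omega
    have hlt : |c * J(y | p) - J(w | p)| ≤ 2 := by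
      rcases hc with rfl | rfl <;> rcases jacobiSym.trichotomy y p with h | h | h <;>
      rcases jacobiSym.trichotomy w p with h' | h' | h' <;> rw [h, h'] <;> decide
    omega)
  linarith

lemma exists_adapted_sum_sq {p₁ p₂ : ℕ} (hp₁ : p₁.Prime) (hp₂ : p₂.Prime) (hm₁ : p₁ % 8 = 5)
    (h2₂ : p₂ ≠ 2) {R S X Y : ℤ} (hRS : (p₁ : ℤ) ∣ R ^ 2 + S ^ 2) (hX : ¬ (p₂ : ℤ) ∣ X) :
    ∃ A B : ℤ, A ^ 2 + B ^ 2 = 2 * p₁ ∧ Odd A ∧ Odd B ∧ IsCoprime A B ∧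
      (p₁ : ℤ) ∣ A * S - B * R ∧ ¬ (p₂ : ℤ) ∣ 2 * X + A * Y := by
  have := Fact.mk hp₁
  have hP₁ : Prime (p₁ : ℤ) := Nat.prime_iff_prime_int.1 hp₁
  have hP₂ : Prime (p₂ : ℤ) := Nat.prime_iff_prime_int.1 hp₂
  obtain ⟨a, b, hab⟩ := Nat.Prime.sq_add_sq (p := p₁) (by omega)
  zify at hab
  have key : ∀ A B : ℤ, A ^ 2 + B ^ 2 = 2 * p₁ → Odd A ∧ Odd B ∧ IsCoprime A B := by
    intro A B h
    have hcop : IsCoprime A B := by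
      rw [Int.isCoprime_iff_gcd_eq_one]
      have hd : A.gcd B * A.gcd B ∣ 2 * p₁ := by
        zify
        rw [← h, ← sq]
        exact dvd_add (pow_dvd_pow_of_dvd (Int.gcd_dvd_left ..) 2)
          (pow_dvd_pow_of_dvd (Int.gcd_dvd_right ..) 2)
      have hsf : Squarefree (2 * p₁) :=
        (Nat.squarefree_mul ((Nat.coprime_primes Nat.prime_two hp₁).2 (by omega))).2
          ⟨Nat.prime_two.prime.squarefree, hp₁.prime.squarefree⟩
      exact Nat.isUnit_iff.1 (hsf _ hd)
    have hev : Even (A ^ 2 + B ^ 2) := h ▸ even_two_mul _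
    have hiff : Odd A ↔ Odd B := by
      rw [Int.even_add'] at hev
      simpa [Int.odd_pow] using hev
    have hA : Odd A := by
      by_contra hA
      have hB := fun h => hA (hiff.2 h)
      rw [Int.not_odd_iff_even] at hA
      exact absurd (hcop.isUnit_of_dvd' (even_iff_two_dvd.1 hA)
        (even_iff_two_dvd.1 (Int.not_odd_iff_even.1 hB))) (by decide)
    exact ⟨hA, hiff.1 hA, hcop⟩
  obtain ⟨A, B, hAB, hd⟩ : ∃ A B : ℤ, A ^ 2 + B ^ 2 = 2 * p₁ ∧ (p₁ : ℤ) ∣ A * S - B * R := by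
    have h : (p₁ : ℤ) ∣ ((a + b) * S - (a - b) * R) * ((a + b) * S - (-(a - b)) * R) := by
      obtain ⟨e, he⟩ := hRS
      exact ⟨2 * S ^ 2 - (a - b) ^ 2 * e, by
        linear_combination 2 * S ^ 2 * hab - (a - b : ℤ) ^ 2 * he⟩
    rcases hP₁.dvd_or_dvd h with h | h
    · exact ⟨_, _, by linear_combination 2 * hab, h⟩
    · exact ⟨_, _, by linear_combination 2 * hab, h⟩
  by_cases hJ : (p₂ : ℤ) ∣ 2 * X + A * Y
  · obtain ⟨h1, h2, h3⟩ := key A B hAB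
    refine ⟨-A, -B, by linear_combination hAB, h1.neg, h2.neg, h3.neg_neg, ?_, fun hJ' => ?_⟩
    · rw [show -A * S - -B * R = -(A * S - B * R) by ring]; exact (dvd_neg).2 hd
    · have h4 : (p₂ : ℤ) ∣ 2 * (2 * X) := by
        have := dvd_add hJ hJ'
        ring_nf at this ⊢
        exact this
      have h2' : ¬ (p₂ : ℤ) ∣ 2 := fun h => h2₂
        ((Nat.prime_dvd_prime_iff_eq hp₂ Nat.prime_two).1 (by exact_mod_cast h))
      exact (hP₂.dvd_or_dvd h4).elim h2' fun h => (hP₂.dvd_or_dvd h).elim h2' hX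
  · obtain ⟨h1, h2, h3⟩ := key A B hAB
    exact ⟨A, B, hAB, h1, h2, h3, hd, hJ⟩

lemma jacobiSym_congr {a b : ℤ} {n : ℕ} (h : (n : ℤ) ∣ a - b) : J(a | n) = J(b | n) :=
  jacobiSym.mod_left' (Int.emod_eq_emod_iff_emod_sub_eq_zero.2 (Int.emod_eq_zero_of_dvd h))

lemma jacobiSym_eq_one_of_dvd_sub_sq {p : ℕ} (hp : p.Prime) {m t : ℤ} (hm : J(m | p) ≠ 0)
    (h : (p : ℤ) ∣ m - t ^ 2) : J(m | p) = 1 := by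
  refine jacobiSym_eq_one_of_mul_sq (k := 1) (t := t) (by simpa using h) isCoprime_one_left
    (isCoprime_of_not_dvd hp fun ht => not_dvd_of_jacobiSym_ne_zero hp hm ?_)
  have := dvd_add h (ht.trans (dvd_pow_self t two_ne_zero))
  simpa using this

lemma IsCoprime.natAbs_right {z n : ℤ} (h : IsCoprime z n) : IsCoprime z (n.natAbs : ℤ) := by
  rw [Int.isCoprime_iff_gcd_eq_one] at h ⊢
  simpa [Int.gcd, Int.natAbs_abs] using h

lemma jacobiSym_sub_of_sum_sq {p : ℕ} (hp : p % 8 = 5) {A B β R S : ℤ} (hA : A = B + 2 * β)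
    (hB : Odd B) (hc : IsCoprime A B) (h : A ^ 2 + B ^ 2 = 2 * p) (hS : J(S | p) = 1)
    (hd : (p : ℤ) ∣ A * S - B * R) : J(R - S | p) = -(J(2 | B.natAbs) * J(β | p)) := by
  have h1 : J(B * (R - S) | p) = J(S * (2 * β) | p) :=
    jacobiSym_congr (by
      rw [show B * (R - S) - S * (2 * β) = -(A * S - B * R) by rw [hA]; ring]
      exact (dvd_neg).2 hd)
  rw [jacobiSym.mul_left, jacobiSym.mul_left, jacobiSym.mul_left, hS, jacobiSym_two_of_five hp,
    jacobiSym_flip (by omega) hB] at h1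
  have h2 : J(2 * p | B.natAbs) = 1 :=
    jacobiSym_eq_one_of_mul_sq (k := 1) (t := A)
      (by rw [Int.natCast_natAbs, abs_dvd]; exact ⟨B, by linear_combination -h⟩)
      isCoprime_one_left hc.natAbs_right
  rw [jacobiSym.mul_left] at h2
  have h3 : J(2 | B.natAbs) * J(2 | B.natAbs) = 1 := by
    rcases jacobiSym_two_natAbs hB with h | h <;> rw [h.1] <;> rfl
  linear_combination J(2 | B.natAbs) * h1 - J(R - S | p) * h2

lemma jacobiSym_cross_of_sum_sq {p₁ p₂ : ℕ} (hp₁ : p₁.Prime) (hp₂ : p₂.Prime)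
    (hm₁ : p₁ % 8 = 5) (hm₂ : p₂ % 8 = 5) {A B β R S r : ℤ} (hA : A = B + 2 * β)
    (hB : Odd B) (hc : IsCoprime A B) (hAB : A ^ 2 + B ^ 2 = 2 * p₁)
    (hR : R = S + 4 * r) (hS : Odd S) (hRS : R ^ 2 + S ^ 2 = 2 * p₁ * p₂)
    (hd : (p₁ : ℤ) ∣ A * S - B * R) (hS₁ : ¬ (p₁ : ℤ) ∣ S) :
    J(A * S + B * R | p₂) = J(β | p₁) ∧ (J(β | p₁) = 1 ∨ J(β | p₁) = -1) := by
  have hP₁ : Prime (p₁ : ℤ) := Nat.prime_iff_prime_int.1 hp₁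
  have hP₂ : Prime (p₂ : ℤ) := Nat.prime_iff_prime_int.1 hp₂
  set Q := B * S + β * S + 2 * r * B with hQ
  set Q' := 2 * r * B + β * S + 4 * r * β with hQ'
  have hQ2 : A * S + B * R = 2 * Q := by rw [hA, hR, hQ]; ring
  have hsum : Q' ^ 2 + Q ^ 2 = (p₁ : ℤ) ^ 2 * p₂ := by
    have : 4 * (Q' ^ 2 + Q ^ 2) = 4 * ((p₁ : ℤ) ^ 2 * p₂) := by
      calc 4 * (Q' ^ 2 + Q ^ 2) = (A ^ 2 + B ^ 2) * (R ^ 2 + S ^ 2) := by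
            rw [hA, hR, hQ, hQ']; ring
        _ = _ := by rw [hAB, hRS]; ring
    linarith
  have hp₁2 : ¬ (p₁ : ℤ) ∣ 2 := fun h => by
    have := (Nat.prime_dvd_prime_iff_eq hp₁ Nat.prime_two).1 (by exact_mod_cast h)
    omega
  have hp₁A : ¬ (p₁ : ℤ) ∣ A := fun h => by
    have h' : (p₁ : ℤ) ∣ B ^ 2 := by
      rw [show B ^ 2 = p₁ * 2 - A * A by linear_combination hAB]
      exact dvd_sub (dvd_mul_right _ _) (h.mul_left _)
    exact hP₁.not_isUnit (hc.isUnit_of_dvd' h (hP₁.dvd_of_dvd_pow h'))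
  have hQ₁ : ¬ (p₁ : ℤ) ∣ Q := fun h => by
    have h' : (p₁ : ℤ) ∣ 2 * (A * S) := by
      rw [show 2 * (A * S) = 2 * Q + (A * S - B * R) by linear_combination hQ2]
      exact dvd_add (h.mul_left _) hd
    exact (hP₁.dvd_or_dvd h').elim hp₁2 fun h => (hP₁.dvd_or_dvd h).elim hp₁A hS₁
  have hcop : IsCoprime Q' Q := by
    rw [isCoprime_comm]
    refine isCoprime_of_prime_dvd (fun h0 => hQ₁ (h0.1 ▸ dvd_zero _)) fun l hl h1 h2 => ?_
    have h3 : l ^ 2 ∣ (p₁ : ℤ) ^ 2 * p₂ := by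
      rw [← hsum]
      exact dvd_add (pow_dvd_pow_of_dvd h2 2) (pow_dvd_pow_of_dvd h1 2)
    have hl1 : IsCoprime l (p₁ : ℤ) := by
      rw [isCoprime_comm]
      refine (hP₁.coprime_iff_not_dvd).2 fun h4 => hQ₁ ?_
      exact ((hP₁.associated_of_dvd hl h4).dvd).trans h1
    have h5 : l ^ 2 ∣ (p₂ : ℤ) := (IsCoprime.pow hl1).dvd_of_dvd_mul_left h3
    rw [sq] at h5
    exact hl.not_isUnit (hP₂.irreducible.squarefree _ h5)
  have hN : Odd (p₁ : ℤ) := by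
    rw [Int.odd_coe_nat, Nat.odd_iff]; omega
  have hJ := jacobiSym_of_sum_sq hm₂ hN (hsum.symm) hcop
  obtain ⟨b, hb⟩ := hB
  have hα : J(β | p₁) = if Even β then -1 else 1 := by
    refine jacobiSym_of_sum_sq (N := 1) (α := B + β) hm₁ odd_one ?_ ?_
    · rw [hA] at hAB; linarith
    · have : IsCoprime (2 * β + B) B := by rw [add_comm, ← hA]; exact hc
      have h2 : IsCoprime β B := ((IsCoprime.add_mul_left_left_iff (z := 1)).1
        (by simpa using this)).of_mul_left_right
      simpa using (h2.symm).add_mul_left_left 1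
  have hpar : Even Q ↔ ¬ Even β := by
    rw [hQ, hb]
    obtain ⟨s, hs⟩ := hS
    rw [hs]
    simp only [Int.even_add, Int.even_mul, even_two, Int.not_even_one]
    tauto
  rw [hQ2, jacobiSym.mul_left, jacobiSym_two_of_five hm₂, hJ, hα]
  by_cases h : Even β
  · rw [if_neg (by rw [hpar]; simpa using h), if_pos h]; decide
  · rw [if_pos (hpar.2 h), if_neg h]; decide

/-- The mod `8` bookkeeping. -/
lemma jacobiSym_two_mul_neg_two {A : ℤ} {X Y n : ℕ} (hA : Odd A) (hX : Odd X) (hY : Odd Y)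
    (hn : (n : ℤ) = 2 * X + A * Y) :
    J(2 | A.natAbs) * J(2 | Y) * J(-2 | n) = J(-1 | X) := by
  have hn' : Odd n := by
    rw [← Int.odd_coe_nat, hn]
    exact (even_two_mul _).add_odd (hA.mul (by exact_mod_cast hY))
  have hA' := Int.natAbs_odd.2 hA
  have := hA'.pos.ne'
  have := hY.pos.ne'
  rw [← jacobiSym.mul_right' _ ‹_› ‹_›, jacobiSym.at_two (hA'.mul hY), jacobiSym.at_neg_two hn',
    jacobiSym.at_neg_one hX, ZMod.χ₈_nat_eq_if_mod_eight, ZMod.χ₈'_nat_eq_if_mod_eight,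
    ZMod.χ₄_nat_eq_if_mod_four]
  have hm : A.natAbs * Y = (A * Y).natAbs := by simp [Int.natAbs_mul]
  rw [hm]
  have hAY : Odd (A * Y) := hA.mul (by exact_mod_cast hY)
  generalize A * Y = a at *
  rw [Nat.odd_iff] at hX hn'
  rw [Int.odd_iff] at hAY
  split_ifs <;> first | rfl | omega

/-- The symbols attached to a primitive point of the conic `2X² = p₁Y² + p₂Z²`. -/
lemma jacobiSym_conic_point {p₁ p₂ X Y Z : ℕ} (hp₁ : p₁.Prime) (hp₂ : p₂.Prime) (hne : p₁ ≠ p₂)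
    (hm₁ : p₁ % 8 = 5) (hm₂ : p₂ % 8 = 5)
    (h : 2 * X ^ 2 = p₁ * Y ^ 2 + p₂ * Z ^ 2) (hX : Odd X) (hY : Odd Y) (hZ : Odd Z)
    (hXY : X.Coprime Y) (hXZ : X.Coprime Z) (hYZ : Y.Coprime Z) :
    ¬ p₂ ∣ X ∧ ¬ p₂ ∣ Y ∧ J(Y | p₂) = J(2 | Y) ∧ J(Z | p₁) = J(2 | Z) ∧
      J(X | p₁) * J(X | p₂) = J(-1 | X) := by
  have c12 : p₁.Coprime p₂ := (Nat.coprime_primes hp₁ hp₂).2 hne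
  have c2 : ∀ {p : ℕ}, p.Prime → p % 8 = 5 → p.Coprime 2 := fun hp hm =>
    (Nat.coprime_primes hp Nat.prime_two).2 (by omega)
  have g1 : ¬ p₁ ∣ Z := fun hd => by
    have h1 : p₁ ∣ 2 * X ^ 2 := h ▸ dvd_add (dvd_mul_right _ _)
      ((hd.trans (dvd_pow_self Z two_ne_zero)).mul_left _)
    have h2 := hp₁.dvd_of_dvd_pow ((c2 hp₁ hm₁).dvd_of_dvd_mul_left h1)
    exact hp₁.one_lt.ne' (Nat.dvd_one.1 (hXZ ▸ Nat.dvd_gcd h2 hd))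
  have g2 : ¬ p₂ ∣ Y := fun hd => by
    have h1 : p₂ ∣ 2 * X ^ 2 := h ▸ dvd_add ((hd.trans (dvd_pow_self Y two_ne_zero)).mul_left _)
      (dvd_mul_right _ _)
    have h2 := hp₂.dvd_of_dvd_pow ((c2 hp₂ hm₂).dvd_of_dvd_mul_left h1)
    exact hp₂.one_lt.ne' (Nat.dvd_one.1 (hXY ▸ Nat.dvd_gcd h2 hd))
  have g3 : ¬ p₂ ∣ X := fun hd => by
    have h1 : p₂ ∣ p₁ * Y ^ 2 := (Nat.dvd_add_left (dvd_mul_right p₂ (Z ^ 2))).1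
      (h ▸ (hd.trans (dvd_pow_self X two_ne_zero)).mul_left _)
    exact g2 (hp₂.dvd_of_dvd_pow (c12.symm.dvd_of_dvd_mul_left h1))
  have g4 : ¬ p₁ ∣ X := fun hd => by
    have h1 : p₁ ∣ p₂ * Z ^ 2 := (Nat.dvd_add_right (dvd_mul_right p₁ (Y ^ 2))).1
      (h ▸ (hd.trans (dvd_pow_self X two_ne_zero)).mul_left _)
    exact g1 (hp₁.dvd_of_dvd_pow (c12.dvd_of_dvd_mul_left h1))
  have cXp₁ : IsCoprime (p₁ : ℤ) X := Nat.isCoprime_iff_coprime.2 ((hp₁.coprime_iff_not_dvd).2 g4)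
  have hz : (2 : ℤ) * X ^ 2 = p₁ * Y ^ 2 + p₂ * Z ^ 2 := by exact_mod_cast h
  have iXY := Nat.isCoprime_iff_coprime.2 hXY
  have iXZ := Nat.isCoprime_iff_coprime.2 hXZ
  have iYZ := Nat.isCoprime_iff_coprime.2 hYZ
  have i2 : ∀ {n : ℕ}, Odd n → IsCoprime (2 : ℤ) n := fun hn => by
    exact_mod_cast Nat.isCoprime_iff_coprime.2 (Nat.coprime_two_left.2 hn)
  have sq1 : ∀ {n : ℕ}, Odd n → J(2 | n) * J(2 | n) = 1 := fun {n} hn => by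
    have hn' : Odd (n : ℤ) := by exact_mod_cast hn
    rcases jacobiSym_two_natAbs hn' with h | h <;> rw [Int.natAbs_natCast] at h <;> rw [h.1] <;> rfl
  refine ⟨g3, g2, ?_, ?_, ?_⟩
  · have h1 : J(2 * p₂ | Y) = 1 := jacobiSym_eq_one_of_mul_sq (k := Z) (t := 2 * X)
      ⟨-2 * p₁ * Y, by linear_combination -2 * hz⟩ iYZ.symm
      (IsCoprime.mul_left (i2 hY) iXY)
    rw [jacobiSym.mul_left, jacobiSym.quadratic_reciprocity_one_mod_four (by omega) hY] at h1
    linear_combination J(2 | Y) * h1 - J(Y | p₂) * sq1 hY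
  · have h1 : J(2 * p₁ | Z) = 1 := jacobiSym_eq_one_of_mul_sq (k := Y) (t := 2 * X)
      ⟨-2 * p₂ * Z, by linear_combination -2 * hz⟩ iYZ
      (IsCoprime.mul_left (i2 hZ) iXZ)
    rw [jacobiSym.mul_left, jacobiSym.quadratic_reciprocity_one_mod_four (by omega) hZ] at h1
    linear_combination J(2 | Z) * h1 - J(Z | p₁) * sq1 hZ
  · have h1 : J(-1 * (p₁ * p₂ : ℤ) | X) = 1 := jacobiSym_eq_one_of_mul_sq (k := Z) (t := p₁ * Y)
      ⟨-2 * p₁ * X, by linear_combination p₁ * hz⟩ iXZ.symm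
      (IsCoprime.mul_left cXp₁ iXY.symm)
    rw [jacobiSym.mul_left, jacobiSym.mul_left,
      jacobiSym.quadratic_reciprocity_one_mod_four (a := p₁) (by omega) hX,
      jacobiSym.quadratic_reciprocity_one_mod_four (a := p₂) (by omega) hX] at h1
    have h2 : J(-1 | X) * J(-1 | X) = 1 := by
      rw [← jacobiSym.mul_left]; simp
    linear_combination J(-1 | X) * h1 - (J(X | p₁) * J(X | p₂)) * h2

lemma jacobiSym_two_mul_of_conic {p₁ p₂ Y Z X : ℕ} (hm₁ : p₁ % 8 = 5) (hm₂ : p₂ % 8 = 5)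
    (h : 2 * X ^ 2 = p₁ * Y ^ 2 + p₂ * Z ^ 2) (hX : Odd X) (hY : Odd Y) (hZ : Odd Z) :
    (-1) ^ ((p₁ * p₂ - 1) / 8) = J(2 | Y) * J(2 | Z) := by
  have hz : (2 : ℤ) * X ^ 2 = p₁ * Y ^ 2 + p₂ * Z ^ 2 := by exact_mod_cast h
  have hX' : Odd (X : ℤ) := by exact_mod_cast hX
  have hY' : Odd (Y : ℤ) := by exact_mod_cast hY
  have hZ' : Odd (Z : ℤ) := by exact_mod_cast hZ
  obtain ⟨x, hx⟩ := Int.exists_sq_eq_of_odd hX'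
  obtain ⟨u, rfl⟩ : ∃ u, p₁ = 8 * u + 5 := ⟨p₁ / 8, by omega⟩
  obtain ⟨v, rfl⟩ : ∃ v, p₂ = 8 * v + 5 := ⟨p₂ / 8, by omega⟩
  have he : ((8 * u + 5) * (8 * v + 5) - 1) / 8 = 2 * (4 * u * v + 2 * u + 2 * v + 1) +
      (u + v + 1) := by
    rw [show (8 * u + 5) * (8 * v + 5) = 8 * (2 * (4 * u * v + 2 * u + 2 * v + 1) +
      (u + v + 1)) + 1 by ring]
    omega
  rw [he, pow_add, pow_mul, neg_one_sq, one_pow, one_mul]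
  push_cast at hz
  rcases jacobiSym_two_natAbs hY' with ⟨e1, k, hk⟩ | ⟨e1, k, hk⟩ <;>
  rcases jacobiSym_two_natAbs hZ' with ⟨e2, l, hl⟩ | ⟨e2, l, hl⟩ <;>
  rw [Int.natAbs_natCast] at e1 e2 <;> rw [e1, e2] <;> rw [hx, hk, hl] at hz <;>
  ring_nf at hz
  · rw [Even.neg_one_pow (by rw [Nat.even_iff]; omega)]; rfl
  · rw [Odd.neg_one_pow (by rw [Nat.odd_iff]; omega)]; rfl
  · rw [Odd.neg_one_pow (by rw [Nat.odd_iff]; omega)]; rfl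
  · rw [Even.neg_one_pow (by rw [Nat.even_iff]; omega)]; rfl

lemma jacobiSym_two_mul_of_sum_sq {p : ℕ} (hm : p % 8 = 5) {A B : ℤ} (hA : Odd A) (hB : Odd B)
    (h : A ^ 2 + B ^ 2 = 2 * p) : J(2 | A.natAbs) * J(2 | B.natAbs) = -1 := by
  rcases jacobiSym_two_natAbs hA with ⟨e1, k, hk⟩ | ⟨e1, k, hk⟩ <;>
  rcases jacobiSym_two_natAbs hB with ⟨e2, l, hl⟩ | ⟨e2, l, hl⟩ <;>
  rw [e1, e2] <;> rw [hk, hl] at h <;> first | rfl | omega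

set_option maxHeartbeats 800000 in
/-- The quartic symbol in terms of a representation of `2p₁p₂` as a sum of two squares. -/
theorem quartic_symbol_product {p₁ p₂ : ℕ} (hp₁ : p₁.Prime) (hp₂ : p₂.Prime) (hne : p₁ ≠ p₂)
    (hm₁ : p₁ % 8 = 5) (hm₂ : p₂ % 8 = 5) (hs : J(p₁ | p₂) = -1)
    {R S r : ℤ} (hRS : R ^ 2 + S ^ 2 = 2 * p₁ * p₂) (hS : Odd S) (hR : R = S + 4 * r)
    (hS₁ : J(S | p₁) = 1) (hS₂ : J(S | p₂) = 1)
    {c d : ℤ} (hc : c = 1 ∨ c = -1) (hd : d = 1 ∨ d = -1)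
    (hccong : (c : ZMod p₂) = ((2 * p₁ : ℕ) : ZMod p₂) ^ ((p₂ - 1) / 4))
    (hdcong : (d : ZMod p₁) = ((2 * p₂ : ℕ) : ZMod p₁) ^ ((p₁ - 1) / 4)) :
    (-1) ^ ((p₁ * p₂ - 1) / 8) * c * d = -J(R - S | p₁) := by
  have := Fact.mk hp₁
  have := Fact.mk hp₂
  have hP₂ : Prime (p₂ : ℤ) := Nat.prime_iff_prime_int.1 hp₂
  have hs' : J(p₂ | p₁) = -1 := by
    rw [← hs, jacobiSym.quadratic_reciprocity_one_mod_four (by omega) (Nat.odd_iff.2 (by omega))]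
  have h2₁ := jacobiSym_two_of_five hm₁
  have h2₂ := jacobiSym_two_of_five hm₂
  obtain ⟨X, Y, Z, h, hX, hY, hZ, hXY, hXZ, hYZ⟩ :=
    exists_primitive_conic_point hp₁ hp₂ hne hm₁ hm₂
      (by
        have : J(2 * p₂ | p₁) = 1 := by rw [jacobiSym.mul_left, h2₁, hs']; rfl
        exact_mod_cast ZMod.isSquare_of_jacobiSym_eq_one this)
      (by
        have : J(2 * p₁ | p₂) = 1 := by rw [jacobiSym.mul_left, h2₂, hs]; rfl
        exact_mod_cast ZMod.isSquare_of_jacobiSym_eq_one this)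
  obtain ⟨hX₂, hY₂, eY, eZ, eX⟩ :=
    jacobiSym_conic_point hp₁ hp₂ hne hm₁ hm₂ h hX hY hZ hXY hXZ hYZ
  have eQ := jacobiSym_two_mul_of_conic hm₁ hm₂ h hX hY hZ
  have hz : (2 : ℤ) * X ^ 2 = p₁ * Y ^ 2 + p₂ * Z ^ 2 := by exact_mod_cast h
  have hX₂' : ¬ (p₂ : ℤ) ∣ X := by rwa [Int.natCast_dvd_natCast]
  obtain ⟨A, B, hAB, hA, hB, hcop, hdvd, hJ⟩ := exists_adapted_sum_sq (Y := Y) hp₁ hp₂ hm₁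
    (by omega) (R := R) (S := S) ⟨2 * p₂, by linear_combination hRS⟩ hX₂'
  obtain ⟨β, hβ⟩ : ∃ β, A = B + 2 * β := by
    obtain ⟨β, hβ⟩ := even_iff_two_dvd.1 (hA.sub_odd hB)
    exact ⟨β, by linear_combination hβ⟩
  have hS₁' : ¬ (p₁ : ℤ) ∣ S := not_dvd_of_jacobiSym_ne_zero hp₁ (by rw [hS₁]; decide)
  have τ := jacobiSym_sub_of_sum_sq hm₁ hβ hB hcop hAB hS₁ hdvd
  obtain ⟨eC, hβ0⟩ := jacobiSym_cross_of_sum_sq hp₁ hp₂ hm₁ hm₂ hβ hB hcop hAB hR hS hRS hdvd hS₁'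
  have eAB := jacobiSym_two_mul_of_sum_sq hm₁ hA hB hAB
  have hXpos : (0 : ℤ) < X := by exact_mod_cast hX.pos
  have hYpos : (0 : ℤ) < Y := by exact_mod_cast hY.pos
  have hZpos : (0 : ℤ) < Z := by exact_mod_cast hZ.pos
  have hp₂pos : (0 : ℤ) < p₂ := by exact_mod_cast hp₂.pos
  have hprod : (2 * X + A * Y) * (2 * X - A * Y) = 2 * p₂ * Z ^ 2 + (B * Y) ^ 2 := by
    linear_combination 2 * hz - Y ^ 2 * hAB
  have hprodpos : 0 < (2 * X + A * Y) * (2 * X - A * Y) := by rw [hprod]; positivity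
  have hnpos : 0 < 2 * X + A * Y := by
    by_contra hneg
    push Not at hneg
    nlinarith
  obtain ⟨n, hn⟩ : ∃ n : ℕ, (n : ℤ) = 2 * X + A * Y := ⟨_, Int.toNat_of_nonneg hnpos.le⟩
  have hY' : Odd (Y : ℤ) := by exact_mod_cast hY
  have hnodd : Odd n := by
    rw [← Int.odd_coe_nat, hn]
    exact (even_two_mul _).add_odd (hA.mul hY')
  rw [← hn] at hJ hprod
  have e8 := jacobiSym_two_mul_neg_two hA hX hY hn
  have hJ' : J(n | p₂) = 1 ∨ J(n | p₂) = -1 :=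
    jacobiSym.eq_one_or_neg_one (Int.isCoprime_iff_gcd_eq_one.1 (isCoprime_of_not_dvd hp₂ hJ))
  have hYJ : J(Y | p₂) = 1 ∨ J(Y | p₂) = -1 :=
    jacobiSym.eq_one_or_neg_one (Int.isCoprime_iff_gcd_eq_one.1
      (isCoprime_of_not_dvd hp₂ (by rwa [Int.natCast_dvd_natCast])))
  have e4 : J(2 * n * Y * (A * S + B * R) * S | p₂) = 1 := by
    refine jacobiSym_eq_one_of_dvd_sub_sq (t := A * S * Y + B * R * Y + 2 * X * S) hp₂ ?_ ?_
    · rw [jacobiSym.mul_left, jacobiSym.mul_left, jacobiSym.mul_left, jacobiSym.mul_left, h2₂, hS₂,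
        eC]
      rcases hJ' with h1 | h1 <;> rcases hYJ with h2 | h2 <;> rcases hβ0 with h3 | h3 <;>
        rw [h1, h2, h3] <;> decide
    · refine ⟨-2 * (Y ^ 2 * B ^ 2 * p₁ + S ^ 2 * Z ^ 2), ?_⟩
      linear_combination 2 * Y * (A * S + B * R) * S * hn - B ^ 2 * Y ^ 2 * hRS +
        S ^ 2 * Y ^ 2 * hAB - 2 * S ^ 2 * hz
  rw [jacobiSym.mul_left, jacobiSym.mul_left, jacobiSym.mul_left, jacobiSym.mul_left, h2₂, hS₂,
        eC] at e4
  have cop : IsCoprime (2 * p₂ : ℤ) n := IsCoprime.mul_left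
    (by exact_mod_cast Nat.isCoprime_iff_coprime.2 (Nat.coprime_two_left.2 hnodd))
    (isCoprime_of_not_dvd hp₂ hJ).symm
  have e5 : J(-(2 * p₂) | n) = 1 := by
    refine jacobiSym_neg_eq_one_of_mul_eq (s := Z) (t := B * Y) (n' := 2 * X - A * Y)
      hnodd.pos.ne' (fun h0 => by rw [h0, mul_zero] at hprodpos; exact hprodpos.false) hprod cop
      fun l hl hln hln' => ?_
    have hL : Prime (l : ℤ) := Nat.prime_iff_prime_int.1 hl
    have hln0 : (l : ℤ) ∣ 2 * X + A * Y := by rw [← hn]; exact_mod_cast hln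
    have hl2 : ¬ (l : ℤ) ∣ 2 := fun h2 => by
      have h3 := (Nat.prime_dvd_prime_iff_eq hl Nat.prime_two).1 (by exact_mod_cast h2)
      exact Nat.not_even_iff_odd.2 hnodd (even_iff_two_dvd.2 (h3 ▸ hln))
    have hlX : (l : ℤ) ∣ X := by
      have h2 : (l : ℤ) ∣ 2 * (2 * X) := by
        rw [show (2 * (2 * X) : ℤ) = 2 * X + A * Y + (2 * X - A * Y) by ring]
        exact dvd_add hln0 hln'
      exact (hL.dvd_or_dvd ((hL.dvd_or_dvd h2).resolve_left hl2)).resolve_left hl2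
    have hlY : ¬ (l : ℤ) ∣ Y := fun h2 => hL.not_isUnit
      ((Nat.isCoprime_iff_coprime.2 hXY).isUnit_of_dvd' hlX h2)
    have hlZ : ¬ (l : ℤ) ∣ Z := fun h2 => hL.not_isUnit
      ((Nat.isCoprime_iff_coprime.2 hXZ).isUnit_of_dvd' hlX h2)
    have hlA : (l : ℤ) ∣ A := by
      have h2 : (l : ℤ) ∣ A * Y := (dvd_add_right (hlX.mul_left 2)).1 hln0
      exact (hL.dvd_or_dvd h2).resolve_right hlY
    have hlB : ¬ (l : ℤ) ∣ B := fun h2 => hL.not_isUnit (hcop.isUnit_of_dvd' hlA h2)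
    refine jacobiSym_eq_one_of_mul_sq (k := Z) (t := B * Y) ?_ (isCoprime_of_not_dvd hl hlZ)
      ((isCoprime_of_not_dvd hl hlB).mul_left (isCoprime_of_not_dvd hl hlY))
    rw [show -(2 * p₂ : ℤ) * Z ^ 2 - (B * Y) ^ 2 = -(n * (2 * X - A * Y)) by
      linear_combination hprod]
    exact (dvd_neg).2 ((Int.natCast_dvd_natCast.2 hln).mul_right _)
  rw [show -(2 * p₂ : ℤ) = -2 * p₂ by ring, jacobiSym.mul_left,
    jacobiSym.quadratic_reciprocity_one_mod_four (by omega) hnodd] at e5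
  have e6 := quartic_mul_jacobiSym hp₂ (by omega) (m := 2 * p₁) (y := Y) (w := 2 * X) hc hccong
    ⟨-2 * Z ^ 2, by push_cast; linear_combination -2 * hz⟩
  have e7 := quartic_mul_jacobiSym hp₁ (by omega) (m := 2 * p₂) (y := Z) (w := 2 * X) hd hdcong
    ⟨-2 * Y ^ 2, by push_cast; linear_combination -2 * hz⟩
  rw [jacobiSym.mul_left, h2₂] at e6
  rw [jacobiSym.mul_left, h2₁] at e7
  rw [τ, eQ]
  rw [eY] at e4 e6 hYJ
  rw [eZ] at e7
  have hA2 : J(2 | A.natAbs) = 1 ∨ J(2 | A.natAbs) = -1 := by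
    rcases jacobiSym_two_natAbs hA with h | h
    exacts [Or.inl h.1, Or.inr h.1]
  have eL : J(2 | Y) * J(2 | Z) * c * d = J(-1 | X) := by
    linear_combination J(2 | Z) * d * e6 - J(X | p₂) * e7 + eX
  rw [eL, ← e8]
  have f1 : J(β | p₁) = -(J(n | p₂) * J(2 | Y)) := by
    rcases hYJ with h2 | h2 <;> rcases hJ' with h3 | h3 <;> simp only [h2, h3] at e4 ⊢ <;> linarith
  have f2 : J(-2 | n) = J(n | p₂) := by
    rcases hJ' with h3 | h3 <;> simp only [h3] at e5 ⊢ <;> linarith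
  have f3 : J(2 | B.natAbs) = -J(2 | A.natAbs) := by
    rcases hA2 with h1 | h1 <;> simp only [h1] at eAB ⊢ <;> linarith
  rw [f1, f2, f3]
  ring

lemma exists_int_of_sq_add_one {D : ℕ} {u v : ℤ} (hv : 0 < v) (h : u ^ 2 + 1 = D * v ^ 2) :
    ∃ R S m n : ℤ, R ^ 2 + S ^ 2 = D ∧ u = R * (m ^ 2 - n ^ 2) - 2 * S * m * n ∧
      1 = S * (m ^ 2 - n ^ 2) + 2 * R * m * n ∧ v = m ^ 2 + n ^ 2 := by
  have hodd : Odd v := by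
    by_contra he
    obtain ⟨e, rfl⟩ := even_iff_two_dvd.1 (Int.not_odd_iff_even.1 he)
    have h4 : u ^ 2 + 1 = 4 * (D * e ^ 2) := by rw [h]; ring
    rcases Int.even_or_odd' u with ⟨c, rfl | rfl⟩ <;> ring_nf at h4 <;> omega
  obtain ⟨k, hk⟩ := Int.exists_sq_eq_of_odd hodd
  let w : GaussianInt := ⟨u, 1⟩
  let i : GaussianInt := ⟨0, 1⟩
  have hnorm : w * star w = D * (v : GaussianInt) ^ 2 := by
    have : (w.norm : GaussianInt) = ((D * v ^ 2 : ℤ) : GaussianInt) := by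
      congr 1; rw [← h, Zsqrtd.norm_def]; simp only [w]; ring
    rw [← Zsqrtd.norm_eq_mul_conj, this]; push_cast; rfl
  have hone : (1 : GaussianInt) = (v : GaussianInt) ^ 2 + 4 * k * i * (w - star w) := by
    have : (v : GaussianInt) ^ 2 = 8 * k + 1 := by exact_mod_cast congrArg (Int.cast) hk
    rw [this]
    have hw : w - star w = 2 * i := by ext <;> simp [w, i]
    have hi : i * i = -1 := by ext <;> simp [i]
    rw [hw]; linear_combination -8 * k * hi
  have hcopa : ∀ a : GaussianInt, a ∣ (v : GaussianInt) ^ 2 → a ∣ w → IsCoprime a (star w) := by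
    rintro a ⟨b, hb⟩ ⟨c, hc⟩
    refine ⟨b + 4 * k * i * c, -(4 * k * i), ?_⟩
    linear_combination -hone - hb - 4 * k * i * hc
  have hcopb : ∀ b : GaussianInt, b ∣ (v : GaussianInt) ^ 2 → b ∣ star w → IsCoprime b w := by
    rintro b ⟨a, ha⟩ ⟨c, hc⟩
    refine ⟨a - 4 * k * i * c, 4 * k * i, ?_⟩
    linear_combination -hone - ha + 4 * k * i * hc
  obtain ⟨a, b, ha, hb, hab⟩ := exists_dvd_and_dvd_of_dvd_mul (Dvd.intro_left _ hnorm.symm)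
  have hstar : star ((v : GaussianInt) ^ 2) = (v : GaussianInt) ^ 2 := by simp
  have hstar' : ∀ {x y : GaussianInt}, x ∣ y → star x ∣ star y := by
    rintro x _ ⟨y, rfl⟩; exact ⟨star y, by simp⟩
  have ha2 : a ∣ (v : GaussianInt) ^ 2 := ⟨b, hab⟩
  have hb2 : b ∣ (v : GaussianInt) ^ 2 := ⟨a, hab.trans (mul_comm _ _)⟩
  have hcop : IsCoprime a b := (hcopa a ha2 ha).of_isCoprime_of_dvd_right hb
  have hna : a.norm ∣ v ^ 2 := by
    have h1 : star a ∣ b := ((hcopa a ha2 ha).of_isCoprime_of_dvd_right (hstar' ha)).symm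
      |>.dvd_of_dvd_mul_left (hab ▸ hstar ▸ hstar' ha2)
    have h2 : (a.norm : GaussianInt) ∣ ((v ^ 2 : ℤ) : GaussianInt) := by
      rw [Zsqrtd.norm_eq_mul_conj]; push_cast; rw [hab]; exact mul_dvd_mul_left _ h1
    exact (Zsqrtd.intCast_dvd_intCast _ _).1 h2
  have hnb : b.norm ∣ v ^ 2 := by
    have hsb : star b ∣ w := by simpa using hstar' hb
    have h1 : star b ∣ a := ((hcopb b hb2 hb).of_isCoprime_of_dvd_right hsb).symm
      |>.dvd_of_dvd_mul_right (hab ▸ hstar ▸ hstar' hb2)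
    have h2 : (b.norm : GaussianInt) ∣ ((v ^ 2 : ℤ) : GaussianInt) := by
      rw [Zsqrtd.norm_eq_mul_conj]; push_cast; rw [hab, mul_comm a]; exact mul_dvd_mul_left _ h1
    exact (Zsqrtd.intCast_dvd_intCast _ _).1 h2
  have hv2 : 0 < v ^ 2 := by positivity
  have hprod : a.norm * b.norm = v ^ 2 * v ^ 2 := by
    rw [← Zsqrtd.norm_mul, ← hab, sq, Zsqrtd.norm_mul, Zsqrtd.norm_intCast]; ring
  have hnav : a.norm = v ^ 2 := by
    have h1 := Int.le_of_dvd hv2 hna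
    have h2 := Int.le_of_dvd hv2 hnb
    nlinarith [GaussianInt.norm_nonneg a, GaussianInt.norm_nonneg b]
  obtain ⟨μ, e, hμ⟩ := exists_associated_pow_of_mul_eq_pow' hcop hab.symm
  obtain ⟨c, hc⟩ := ha
  have hμv : μ.norm = v := by
    have h1 : μ.norm ^ 2 = v ^ 2 := by
      rw [← hnav, ← hμ, Zsqrtd.norm_mul, sq, sq, Zsqrtd.norm_mul]
      have := (Zsqrtd.norm_eq_one_iff' (by norm_num) (e : GaussianInt)).2 e.isUnit
      rw [this, mul_one]
    exact (pow_left_inj₀ (GaussianInt.norm_nonneg μ) hv.le two_ne_zero).1 h1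
  obtain ⟨z, hw⟩ : ∃ z, w = z * μ ^ 2 := ⟨e * c, by rw [hc, ← hμ]; ring⟩
  have hzn : z.norm = D := by
    have h1 : w.norm = D * v ^ 2 := by rw [← h, Zsqrtd.norm_def]; simp only [w]; ring
    rw [hw, Zsqrtd.norm_mul, sq μ, Zsqrtd.norm_mul, hμv, ← sq] at h1
    exact mul_right_cancel₀ hv2.ne' h1
  have hre := congrArg Zsqrtd.re hw
  have him := congrArg Zsqrtd.im hw
  rw [Zsqrtd.norm_def] at hzn hμv
  simp only [w, sq, Zsqrtd.re_mul, Zsqrtd.im_mul] at hre him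
  exact ⟨z.re, z.im, μ.re, μ.im, by linear_combination hzn, by linear_combination hre,
    by linear_combination him, by linear_combination -hμv⟩

lemma even_of_sq_sub_mul_sq {D : ℤ} (hD : D % 8 = 1 ∨ D % 8 = 2) {x y : ℤ}
    (h : x ^ 2 - D * y ^ 2 = 4 ∨ x ^ 2 - D * y ^ 2 = -4) : Even x ∧ Even y := by
  by_contra hne
  have key : ∀ z : ℤ, (Even z ∧ (z ^ 2 % 8 = 0 ∨ z ^ 2 % 8 = 4)) ∨ (¬ Even z ∧ z ^ 2 % 8 = 1) := by
    intro z
    by_cases hz : Even z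
    · left
      obtain ⟨c, rfl⟩ := hz
      refine ⟨⟨c, rfl⟩, ?_⟩
      rcases Int.even_or_odd' c with ⟨e, rfl | rfl⟩ <;> ring_nf <;> omega
    · right
      obtain ⟨c, hc⟩ := Int.exists_sq_eq_of_odd (Int.not_even_iff_odd.1 hz)
      exact ⟨hz, by omega⟩
  have hmul := Int.mul_emod D (y ^ 2) 8
  rcases key x with ⟨h1, h2 | h2⟩ | ⟨h1, h2⟩ <;> rcases key y with ⟨h3, h4 | h4⟩ | ⟨h3, h4⟩ <;>
    first | exact hne ⟨h1, h3⟩ | (rcases hD with hD | hD <;> rw [hD, h4] at hmul <;> omega)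

lemma IsFundUnit.exists_int {D : ℕ} {ε : ℝ} (hD : D % 8 = 1 ∨ D % 8 = 2) (hε : IsFundUnit D ε) :
    ∃ u v : ℤ, 0 < u ∧ 0 < v ∧ ε = u + v * √D ∧
      (u ^ 2 - D * v ^ 2 = 1 ∨ u ^ 2 - D * v ^ 2 = -1) := by
  obtain ⟨h1, ⟨x, y, rfl, hxy⟩, -⟩ := hε
  obtain ⟨⟨u, rfl⟩, ⟨v, rfl⟩⟩ := even_of_sq_sub_mul_sq (by omega) hxy
  have hD0 : (0 : ℝ) < √D := Real.sqrt_pos.2 (by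
    have : 0 < D := by omega
    exact_mod_cast this)
  have hsq : √D ^ 2 = D := Real.sq_sqrt (Nat.cast_nonneg D)
  push_cast at h1 ⊢
  have hn : u ^ 2 - D * v ^ 2 = 1 ∨ u ^ 2 - D * v ^ 2 = -1 := by
    rcases hxy with h | h
    · left; linarith
    · right; linarith
  have hab : |(u + v * √D) * (u - v * √D)| = 1 := by
    have h3 : (u + v * √D) * (u - v * √D) = ((u ^ 2 - D * v ^ 2 : ℤ) : ℝ) := by
      push_cast; linear_combination -v ^ 2 * hsq
    rw [h3]
    rcases hn with h | h <;> rw [h] <;> simp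
  rw [abs_mul, abs_of_pos (by linarith : 0 < u + v * √D)] at hab
  have h4 : |u - v * √D| < 1 := by
    by_contra hge
    push Not at hge
    nlinarith
  rw [abs_lt] at h4
  refine ⟨u, v, ?_, ?_, by ring, hn⟩
  · have : (0 : ℝ) < u := by linarith
    exact_mod_cast this
  · have : (0 : ℝ) < v * √D := by linarith
    have := (pos_iff_pos_of_mul_pos this).2 hD0
    exact_mod_cast this

lemma IsFundUnit.le {D : ℕ} {ε : ℝ} (hε : IsFundUnit D ε) {s t : ℤ}
    (h : s ^ 2 - D * t ^ 2 = 1 ∨ s ^ 2 - D * t ^ 2 = -1) (h1 : 1 < s + t * √D) :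
    ε ≤ s + t * √D := by
  have := hε.2.2 (2 * s) (2 * t)
    (h.imp (fun h => by linear_combination 4 * h) fun h => by linear_combination 4 * h)
  push_cast at this
  rw [show (2 * (s : ℝ) + 2 * t * √D) / 2 = s + t * √D by ring] at this
  exact this h1

/-- If no nontrivial factorization `D = d₁d₂` admits `d₂t² - d₁s² = 1`, then the fundamental unit
has norm `-1`. -/
lemma IsFundUnit.exists_int_of_neg_one {D : ℕ} {ε : ℝ} (hD : D % 8 = 1 ∨ D % 8 = 2)
    (hε : IsFundUnit D ε)
    (hno : ∀ d₁ d₂ : ℕ, D = d₁ * d₂ → d₁ ≠ 1 → d₂ ≠ 1 → ∀ s t : ℕ, d₁ * s ^ 2 + 1 ≠ d₂ * t ^ 2) :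
    ∃ u v : ℤ, 0 < v ∧ ε = u + v * √D ∧ u ^ 2 + 1 = D * v ^ 2 := by
  obtain ⟨u, v, hu, hv, hεe, h | h⟩ := hε.exists_int hD
  swap
  · exact ⟨u, v, hv, hεe, by linear_combination h⟩
  exfalso
  have hD0 : 0 < D := by omega
  obtain ⟨w, rfl⟩ : ∃ w, v = 2 * w := by
    rw [← dvd_def, ← even_iff_two_dvd]
    by_contra hvo
    obtain ⟨c, hc⟩ := Int.exists_sq_eq_of_odd (Int.not_even_iff_odd.1 hvo)
    rw [hc] at h
    obtain ⟨e, he | he⟩ : ∃ e : ℤ, (D : ℤ) = 8 * e + 1 ∨ (D : ℤ) = 8 * e + 2 := ⟨D / 8, by omega⟩ <;>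
      rw [he] at h <;> rcases Int.even_or_odd' u with ⟨f, rfl | rfl⟩ <;> ring_nf at h <;> omega
  obtain ⟨k, rfl⟩ : ∃ k, u = 2 * k + 1 := by
    rcases Int.even_or_odd' u with ⟨f, rfl | rfl⟩
    · ring_nf at h; omega
    · exact ⟨f, rfl⟩
  obtain ⟨K, rfl⟩ := Int.eq_ofNat_of_zero_le (by omega : 0 ≤ k)
  obtain ⟨W, rfl⟩ := Int.eq_ofNat_of_zero_le (by omega : 0 ≤ w)
  have hW : 0 < W := by omega
  have hK : K * (K + 1) = D * W ^ 2 := by zify; linarith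
  obtain ⟨d₁, d₂, ⟨k₁, hk₁⟩, ⟨k₂, hk₂⟩, rfl⟩ := exists_dvd_and_dvd_of_dvd_mul (Dvd.intro _ hK.symm)
  have hkk : k₁ * k₂ = W ^ 2 := by
    apply Nat.eq_of_mul_eq_mul_left hD0
    rw [← hK]; conv_rhs => rw [hk₂]
    nth_rw 1 [hk₁]; ring
  have hcop : k₁.Coprime k₂ := by
    have : K.Coprime (K + 1) := by simp
    rw [hk₂] at this
    exact (this.coprime_dvd_left ⟨d₁, by rw [hk₁, mul_comm]⟩).coprime_dvd_right (dvd_mul_left _ _)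
  obtain ⟨s, rfl⟩ := exists_eq_pow_of_mul_eq_pow (Nat.isUnit_iff.2 hcop) hkk
  obtain ⟨t, rfl⟩ := exists_eq_pow_of_mul_eq_pow (Nat.isUnit_iff.2 (Nat.Coprime.symm hcop))
    (mul_comm (s ^ 2) _ ▸ hkk)
  have hst : s * t = W := by
    rw [← mul_pow] at hkk
    exact Nat.pow_left_injective two_ne_zero hkk
  have hs : 0 < s := Nat.pos_of_ne_zero (by rintro rfl; omega)
  have ht : 0 < t := Nat.pos_of_ne_zero (by rintro rfl; omega)
  have h1 := hε.1
  have hδ : (1 : ℝ) ≤ √((d₁ * d₂ : ℕ)) := by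
    rw [Real.one_le_sqrt]; exact_mod_cast hD0
  have hδ2 : √((d₁ * d₂ : ℕ)) ^ 2 = ((d₁ * d₂ : ℕ) : ℝ) := Real.sq_sqrt (Nat.cast_nonneg _)
  have fin : ∀ η : ℝ, 1 < η → ε ≤ η → ε = η ^ 2 → False := fun η h2 h3 h4 => by nlinarith
  have hs' : (1 : ℝ) ≤ s := by exact_mod_cast hs
  have ht' : (1 : ℝ) ≤ t := by exact_mod_cast ht
  by_cases hd₁ : d₁ = 1
  · subst hd₁
    rw [one_mul] at *
    have e : s ^ 2 + 1 = d₂ * t ^ 2 := by rw [← hk₂, hk₁]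
    have hη : 1 < (s : ℤ) + (t : ℤ) * √d₂ := by push_cast; nlinarith
    refine fin _ hη (hε.le (Or.inr (by zify at e; linear_combination e)) hη) ?_
    rw [hεe, ← hst, hk₁]
    have e' : (s : ℝ) ^ 2 + 1 = d₂ * t ^ 2 := by exact_mod_cast e
    push_cast
    linear_combination e' - t ^ 2 * hδ2
  by_cases hd₂ : d₂ = 1
  · subst hd₂
    rw [mul_one] at *
    have e : d₁ * s ^ 2 + 1 = t ^ 2 := by rw [← hk₁, hk₂, one_mul]
    have hη : 1 < (t : ℤ) + (s : ℤ) * √d₁ := by push_cast; nlinarith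
    refine fin _ hη (hε.le (Or.inl (by zify at e; linear_combination -e)) hη) ?_
    rw [hεe, ← hst, hk₁]
    have e' : d₁ * (s : ℝ) ^ 2 + 1 = t ^ 2 := by exact_mod_cast e
    push_cast
    linear_combination e' - s ^ 2 * hδ2
  exact hno d₁ d₂ rfl hd₁ hd₂ s t (by rw [← hk₁, ← hk₂])

lemma jacobiSym_eq_one_of_sum_sq_param {p D : ℕ} (hp : p.Prime) (hpD : p ∣ D)
    {R S m n : ℤ} (h : R ^ 2 + S ^ 2 = D) (h1 : 1 = S * (m ^ 2 - n ^ 2) + 2 * R * m * n) :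
    J(S | p) = 1 := by
  have hP : Prime (p : ℤ) := Nat.prime_iff_prime_int.1 hp
  obtain ⟨e, rfl⟩ := hpD
  push_cast at h
  have hS : ¬ (p : ℤ) ∣ S := fun hd => by
    have h2 : (p : ℤ) ∣ R ^ 2 := by
      rw [show R ^ 2 = p * e - S * S by linear_combination h]
      exact dvd_sub (dvd_mul_right _ _) (hd.mul_left _)
    have h3 := hP.dvd_of_dvd_pow h2
    refine hP.not_dvd_one ?_
    rw [h1]
    exact dvd_add (hd.mul_right _) (((h3.mul_left 2).mul_right m).mul_right n)
  refine jacobiSym_eq_one_of_dvd_sub_sq (t := S * m + R * n) hp (fun h0 => hS ?_)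
    ⟨-(e * n ^ 2), by linear_combination S * h1 - n ^ 2 * h⟩
  have := (jacobiSym.eq_zero_iff.1 h0).2
  by_contra hd
  exact this (Int.isCoprime_iff_gcd_eq_one.1 (isCoprime_of_not_dvd hp hd))

lemma IsFundUnit.exists_sum_sq {D : ℕ} {ε : ℝ} (hD : D % 8 = 1 ∨ D % 8 = 2)
    (hε : IsFundUnit D ε)
    (hno : ∀ d₁ d₂ : ℕ, D = d₁ * d₂ → d₁ ≠ 1 → d₂ ≠ 1 → ∀ s t : ℕ, d₁ * s ^ 2 + 1 ≠ d₂ * t ^ 2) :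
    ∃ R S : ℤ, R ^ 2 + S ^ 2 = D ∧ Odd S ∧
      (∀ p : ℕ, p.Prime → p ∣ D → J(S | p) = 1) ∧
      ∀ K : IntermediateField ℚ ℝ, √D ∈ K → ∀ σ : ℤ, σ = 1 ∨ σ = -1 →
        ∃ k ∈ K, k ^ 2 = ε * (σ * R + √D) := by
  obtain ⟨u, v, hv, rfl, huv⟩ := hε.exists_int_of_neg_one hD hno
  obtain ⟨R, S, m, n, hRS, hu, h1, rfl⟩ := exists_int_of_sq_add_one hv huv
  have hS : Odd S := by
    by_contra he
    obtain ⟨e, rfl⟩ := even_iff_two_dvd.1 (Int.not_odd_iff_even.1 he)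
    have : (1 : ℤ) = 2 * (e * (m ^ 2 - n ^ 2) + R * m * n) := by linear_combination h1
    omega
  refine ⟨R, S, hRS, hS, fun p hp hpD => jacobiSym_eq_one_of_sum_sq_param hp hpD hRS h1, ?_⟩
  intro K hK σ hσ
  have hδ : √(D : ℝ) ^ 2 = D := Real.sq_sqrt (Nat.cast_nonneg _)
  have hRS' : (R : ℝ) ^ 2 + (S : ℝ) ^ 2 = D := by exact_mod_cast hRS
  have h1' : (1 : ℝ) = S * (m ^ 2 - n ^ 2) + 2 * R * m * n := by exact_mod_cast h1
  have hu' : (u : ℝ) = R * (m ^ 2 - n ^ 2) - 2 * S * m * n := by exact_mod_cast hu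
  have hS0 : (S : ℝ) ≠ 0 := by
    have : S ≠ 0 := by rintro rfl; simp at hS
    exact_mod_cast this
  have intMem : ∀ a : ℤ, (a : ℝ) ∈ K := fun a => intCast_mem K a
  have key : (u + ((m ^ 2 + n ^ 2 : ℤ) : ℝ) * √D) * (R + √D) =
      (R * m - S * n + m * √D) ^ 2 := by
    push_cast
    rw [hu']
    linear_combination (n ^ 2 : ℝ) * hδ - n ^ 2 * hRS'
  rcases hσ with rfl | rfl
  · refine ⟨R * m - S * n + m * √D, ?_, by rw [← key]; push_cast; ring⟩
    exact add_mem (sub_mem (mul_mem (intMem _) (intMem _)) (mul_mem (intMem _) (intMem _)))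
      (mul_mem (intMem _) hK)
  · have hR0 : (R : ℝ) + √D ≠ 0 := fun h0 => by
      apply hS0
      have : (S : ℝ) ^ 2 = 0 := by linear_combination hRS' - hδ + (√D - R) * h0
      exact pow_eq_zero_iff two_ne_zero |>.1 this
    refine ⟨(R * m - S * n + m * √D) * S / (R + √D), ?_, ?_⟩
    · exact div_mem (mul_mem (add_mem (sub_mem (mul_mem (intMem _) (intMem _))
        (mul_mem (intMem _) (intMem _))) (mul_mem (intMem _) hK)) (intMem _)) (add_mem (intMem _) hK)
    · rw [div_pow, mul_pow, ← key]
      field_simp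
      push_cast
      linear_combination (u + (m ^ 2 + n ^ 2 : ℝ) * √D) * (hRS' - hδ)

lemma mul_sq_add_one_ne {d₁ d₂ p : ℕ} (hp : p.Prime) (hm : p % 4 = 1)
    (h : (p ∣ d₁ ∧ J(d₂ | p) = -1) ∨ (p ∣ d₂ ∧ J(d₁ | p) = -1)) (s t : ℕ) :
    d₁ * s ^ 2 + 1 ≠ d₂ * t ^ 2 := by
  have hP : Prime (p : ℤ) := Nat.prime_iff_prime_int.1 hp
  intro he
  zify at he
  rcases h with ⟨⟨e, rfl⟩, h⟩ | ⟨⟨e, rfl⟩, h⟩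
  · push_cast at he
    have ht : ¬ (p : ℤ) ∣ t := fun hd => by
      refine hP.not_dvd_one ?_
      rw [show (1 : ℤ) = t * (d₂ * t) - p * (e * s ^ 2) by linear_combination he]
      exact dvd_sub (hd.mul_right _) (dvd_mul_right _ _)
    rw [jacobiSym_eq_one_of_mul_sq (k := t) (t := 1) ⟨e * s ^ 2, by linear_combination -he⟩
      (isCoprime_of_not_dvd hp ht) isCoprime_one_left] at h
    exact absurd h (by decide)
  · push_cast at he
    have ht : ¬ (p : ℤ) ∣ s := fun hd => by
      refine hP.not_dvd_one ?_
      rw [show (1 : ℤ) = p * (e * t ^ 2) - s * (d₁ * s) by linear_combination he]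
      exact dvd_sub (dvd_mul_right _ _) (hd.mul_right _)
    have h2 := jacobiSym_eq_one_of_mul_sq (m := -d₁) (k := s) (t := 1) (n := p)
      ⟨-(e * t ^ 2), by linear_combination -he⟩ (isCoprime_of_not_dvd hp ht) isCoprime_one_left
    rw [jacobiSym.neg _ (Nat.odd_iff.2 (by omega)), ZMod.χ₄_nat_one_mod_four hm, h] at h2
    exact absurd h2 (by decide)

lemma mul_sq_add_one_ne_of_factor {p₁ p₂ g : ℕ} (hp₁ : p₁.Prime) (hp₂ : p₂.Prime)
    (hm₁ : p₁ % 8 = 5) (hm₂ : p₂ % 8 = 5) (hs : J(p₁ | p₂) = -1) (hg : g ∣ 2) {d₁ d₂ : ℕ}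
    (hd : g * p₁ * p₂ = d₁ * d₂) (h₁ : d₁ ≠ 1) (h₂ : d₂ ≠ 1) (s t : ℕ) :
    d₁ * s ^ 2 + 1 ≠ d₂ * t ^ 2 := by
  have hs' : J(p₂ | p₁) = -1 := by
    rw [← hs, jacobiSym.quadratic_reciprocity_one_mod_four (by omega) (Nat.odd_iff.2 (by omega))]
  have two : ∀ {f : ℕ}, f ∣ 2 → f = 1 ∨ f = 2 := fun h => (Nat.dvd_prime Nat.prime_two).1 h
  have key : ∀ {d₁ d₂ : ℕ}, g * p₁ * p₂ = d₁ * d₂ → d₂ ≠ 1 → p₁ ∣ d₁ →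
      J(d₂ | p₁) = -1 ∨ p₂ ∣ d₂ ∧ J(d₁ | p₂) = -1 := by
    rintro d₁ d₂ hd h₂ ⟨e, rfl⟩
    have he : g * p₂ = e * d₂ := by
      apply Nat.eq_of_mul_eq_mul_left hp₁.pos; linarith
    rcases hp₂.dvd_mul.1 (Dvd.intro_left _ he) with ⟨f, rfl⟩ | ⟨f, rfl⟩
    · have hf : g = f * d₂ := by
        apply Nat.eq_of_mul_eq_mul_left hp₂.pos; linarith
      rcases two ((Dvd.intro_left _ hf.symm).trans hg) with rfl | rfl
      · exact absurd rfl h₂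
      · exact Or.inl (jacobiSym_two_of_five hm₁)
    · have hf : g = e * f := by
        apply Nat.eq_of_mul_eq_mul_left hp₂.pos; linarith
      rcases two ((Dvd.intro_left _ hf.symm).trans hg) with rfl | rfl
      · left; simpa using hs'
      · have he1 : e = 1 := by
          rcases two hg with rfl | rfl <;> omega
        subst he1
        exact Or.inr ⟨dvd_mul_right _ _, by simpa using hs⟩
  rcases hp₁.dvd_mul.1 (show p₁ ∣ d₁ * d₂ from hd ▸ ⟨g * p₂, by ring⟩) with h | h
  · rcases key hd h₂ h with h' | ⟨h', h''⟩
    · exact mul_sq_add_one_ne hp₁ (by omega) (Or.inl ⟨h, h'⟩) s t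
    · exact mul_sq_add_one_ne hp₂ (by omega) (Or.inr ⟨h', h''⟩) s t
  · rcases key (hd.trans (mul_comm _ _)) h₁ h with h' | ⟨h', h''⟩
    · exact mul_sq_add_one_ne hp₁ (by omega) (Or.inr ⟨h, h'⟩) s t
    · exact mul_sq_add_one_ne hp₂ (by omega) (Or.inl ⟨h', h''⟩) s t

lemma Nat.Prime.not_isSquare_mul {p n : ℕ} (hp : p.Prime) (h : ¬ p ∣ n) : ¬ IsSquare (p * n) := by
  rintro ⟨r, hr⟩
  have h1 : p ∣ r := by
    have : p ∣ r * r := hr ▸ dvd_mul_right _ _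
    exact (hp.dvd_mul.1 this).elim id id
  obtain ⟨s, rfl⟩ := h1
  exact h ⟨s * s, Nat.eq_of_mul_eq_mul_left hp.pos (by rw [hr]; ring)⟩

lemma isSquare_mul_of_rat {n m : ℕ} {r : ℚ} (h : n * r ^ 2 = m) : IsSquare (n * m) := by
  rw [← Rat.isSquare_natCast_iff]
  exact ⟨n * r, by push_cast; rw [← h]; ring⟩

/-- `1` and `√2` are linearly independent over `ℚ`. -/
lemma eq_zero_of_add_mul_sqrt_two {x y : ℚ} (h : (x : ℝ) + y * √2 = 0) : x = 0 ∧ y = 0 := by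
  by_cases hy : y = 0
  · subst hy; simpa using h
  · exfalso
    apply irrational_sqrt_two
    refine ⟨-x / y, ?_⟩
    have : (y : ℝ) ≠ 0 := by exact_mod_cast hy
    push_cast
    field_simp
    linear_combination -h

lemma eq_zero_of_add_mul_sqrt {q : ℕ} (hq : ¬ IsSquare q) (h2q : ¬ IsSquare (2 * q)) {x y z w : ℚ}
    (h : (x : ℝ) + y * √2 + (z + w * √2) * √q = 0) : x = 0 ∧ y = 0 ∧ z = 0 ∧ w = 0 := by
  have s2 : √2 ^ 2 = (2 : ℝ) := Real.sq_sqrt (by norm_num)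
  have sq : √(q : ℝ) ^ 2 = q := Real.sq_sqrt (Nat.cast_nonneg _)
  suffices hzw : z = 0 ∧ w = 0 by
    obtain ⟨rfl, rfl⟩ := hzw
    have := eq_zero_of_add_mul_sqrt_two (x := x) (y := y) (by simpa using h)
    exact ⟨this.1, this.2, rfl, rfl⟩
  by_contra hne
  have hN : z ^ 2 - 2 * w ^ 2 ≠ 0 := fun h0 => by
    by_cases hw : w = 0
    · subst hw; exact hne ⟨by simpa using h0, rfl⟩
    · have h1 : ((1 : ℕ) : ℚ) * (z / w) ^ 2 = (2 : ℕ) := by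
        field_simp; push_cast; linarith
      have := isSquare_mul_of_rat h1
      exact Nat.prime_two.prime.irreducible.not_isSquare (by simpa using this)
  obtain ⟨α, β, hαβ⟩ : ∃ α β : ℚ, √(q : ℝ) = α + β * √2 := by
    refine ⟨-(x * z - 2 * y * w) / (z ^ 2 - 2 * w ^ 2), -(y * z - x * w) / (z ^ 2 - 2 * w ^ 2), ?_⟩
    have hN' : (z : ℝ) ^ 2 - 2 * w ^ 2 ≠ 0 := by exact_mod_cast hN
    push_cast
    field_simp
    linear_combination (z - w * √2) * h + (y * w + w ^ 2 * √q) * s2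
  have h3 : ((α ^ 2 + 2 * β ^ 2 - q : ℚ) : ℝ) + ((2 * α * β : ℚ) : ℝ) * √2 = 0 := by
    push_cast
    rw [hαβ] at sq
    linear_combination sq - β ^ 2 * s2
  obtain ⟨h4, h5⟩ := eq_zero_of_add_mul_sqrt_two h3
  rcases mul_eq_zero.1 h5 with h6 | h6
  · have h7 : α = 0 := by linarith
    subst h7
    exact h2q (isSquare_mul_of_rat (n := 2) (r := β) (by push_cast; linarith))
  · subst h6
    exact hq (by
      simpa using isSquare_mul_of_rat (n := 1) (m := q) (r := α) (by push_cast; linarith))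

lemma exists_rat_of_mem_adjoin {q : ℕ} {t : ℝ} (ht : t ∈ ℚ⟮√2, √(q : ℝ)⟯) :
    ∃ a b c d : ℚ, t = a + b * √2 + (c + d * √2) * √q := by
  have s2 : √2 ^ 2 = (2 : ℝ) := Real.sq_sqrt (by norm_num)
  have sq : √(q : ℝ) ^ 2 = q := Real.sq_sqrt (Nat.cast_nonneg _)
  have halg : ∀ x ∈ ({√2, √(q : ℝ)} : Set ℝ), IsAlgebraic ℚ x := by
    have key : ∀ n : ℕ, IsAlgebraic ℚ √(n : ℝ) := fun n =>
      IsAlgebraic.of_pow two_pos (by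
        rw [Real.sq_sqrt (Nat.cast_nonneg _)]; exact isAlgebraic_natCast n)
    rintro x (rfl | rfl)
    · exact_mod_cast key 2
    · exact key q
  rw [← IntermediateField.mem_toSubalgebra,
    IntermediateField.adjoin_toSubalgebra_of_isAlgebraic halg] at ht
  induction ht using Algebra.adjoin_induction with
  | mem x hx =>
    rcases hx with rfl | rfl
    · exact ⟨0, 1, 0, 0, by simp⟩
    · exact ⟨0, 0, 1, 0, by simp⟩
  | algebraMap r => exact ⟨r, 0, 0, 0, by simp⟩
  | add x y _ _ hx hy =>
    obtain ⟨a, b, c, d, rfl⟩ := hx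
    obtain ⟨a', b', c', d', rfl⟩ := hy
    exact ⟨a + a', b + b', c + c', d + d', by push_cast; ring⟩
  | mul x y _ _ hx hy =>
    obtain ⟨a, b, c, d, rfl⟩ := hx
    obtain ⟨a', b', c', d', rfl⟩ := hy
    refine ⟨a * a' + 2 * b * b' + q * (c * c' + 2 * d * d'),
      a * b' + b * a' + q * (c * d' + d * c'),
      a * c' + c * a' + 2 * (b * d' + d * b'), a * d' + d * a' + b * c' + c * b', ?_⟩
    push_cast
    linear_combination (b * b' + (b * d' + d * b') * √q + d * d' * √q ^ 2) * s2 +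
      (c * c' + (c * d' + d * c') * √2 + 2 * d * d') * sq

lemma sq_ne_prime_of_mem_adjoin {p₁ p₂ : ℕ} (hp₁ : p₁.Prime) (hp₂ : p₂.Prime) (hne : p₁ ≠ p₂)
    (h₁ : p₁ ≠ 2) (h₂ : p₂ ≠ 2) {t : ℝ} (ht : t ∈ ℚ⟮√2, √((p₁ * p₂ : ℕ) : ℝ)⟯) : t ^ 2 ≠ p₂ := by
  intro h
  obtain ⟨a, b, c, d, rfl⟩ := exists_rat_of_mem_adjoin ht
  have s2 : √2 ^ 2 = (2 : ℝ) := Real.sq_sqrt (by norm_num)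
  have sq : √((p₁ * p₂ : ℕ) : ℝ) ^ 2 = ((p₁ * p₂ : ℕ) : ℝ) := Real.sq_sqrt (Nat.cast_nonneg _)
  have n12 : ¬ p₁ ∣ p₂ := fun h => hne ((Nat.prime_dvd_prime_iff_eq hp₁ hp₂).1 h)
  have n21 : ¬ p₂ ∣ p₁ := fun h => hne ((Nat.prime_dvd_prime_iff_eq hp₂ hp₁).1 h).symm
  have n1 : ¬ p₁ ∣ 2 := fun h => h₁ ((Nat.prime_dvd_prime_iff_eq hp₁ Nat.prime_two).1 h)
  have n2 : ¬ p₂ ∣ 2 := fun h => h₂ ((Nat.prime_dvd_prime_iff_eq hp₂ Nat.prime_two).1 h)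
  have hq : ¬ IsSquare (p₁ * p₂) := hp₁.not_isSquare_mul n12
  have h2q : ¬ IsSquare (2 * (p₁ * p₂)) := by
    rw [show 2 * (p₁ * p₂) = p₁ * (2 * p₂) by ring]
    exact hp₁.not_isSquare_mul fun h => (hp₁.dvd_mul.1 h).elim n1 n12
  obtain ⟨e1, e2, e3, e4⟩ := eq_zero_of_add_mul_sqrt hq h2q
    (x := a ^ 2 + 2 * b ^ 2 + (p₁ * p₂ : ℕ) * (c ^ 2 + 2 * d ^ 2) - p₂)
    (y := 2 * (a * b + (p₁ * p₂ : ℕ) * (c * d))) (z := 2 * (a * c + 2 * b * d))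
    (w := 2 * (a * d + b * c)) (by
      push_cast at h sq ⊢
      linear_combination h - (b ^ 2 + 2 * b * d * √(p₁ * p₂) + d ^ 2 * √(p₁ * p₂) ^ 2) * s2 -
        (c ^ 2 + 2 * c * d * √2 + 2 * d ^ 2) * sq)
  have f1 : b * (c ^ 2 - 2 * d ^ 2) = 0 := by linear_combination c * e4 / 2 - d * e3 / 2
  have c1 : ∀ r : ℚ, r ^ 2 ≠ p₂ := fun r hr =>
    hp₂.not_isSquare_mul (n := 1) (fun h => n2 (h.trans (one_dvd 2)))
      (by simpa using isSquare_mul_of_rat (n := 1) (m := p₂) (r := r) (by simpa using hr))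
  have c2 : ∀ r : ℚ, 2 * r ^ 2 ≠ p₂ := fun r hr =>
    hp₂.not_isSquare_mul n2
      (mul_comm 2 p₂ ▸ isSquare_mul_of_rat (n := 2) (m := p₂) (r := r) (by simpa using hr))
  have c3 : ∀ r : ℚ, (p₁ * p₂ : ℕ) * r ^ 2 ≠ p₂ := fun r hr =>
    hp₁.not_isSquare_mul (n := p₂ * p₂) (fun h => (hp₁.dvd_mul.1 h).elim n12 n12)
      (mul_assoc p₁ p₂ p₂ ▸ isSquare_mul_of_rat hr)
  have c4 : ∀ r : ℚ, (p₁ * p₂ : ℕ) * (2 * r ^ 2) ≠ p₂ := fun r hr =>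
    hp₁.not_isSquare_mul (n := 2 * (p₂ * p₂))
      (fun h => (hp₁.dvd_mul.1 h).elim n1 fun h => (hp₁.dvd_mul.1 h).elim n12 n12) (by
        have := isSquare_mul_of_rat (n := 2 * (p₁ * p₂)) (m := p₂) (r := r)
          (by push_cast at hr ⊢; linear_combination hr)
        rwa [show p₁ * (2 * (p₂ * p₂)) = 2 * (p₁ * p₂) * p₂ by ring])
  have hcd : b = 0 ∨ (c = 0 ∧ d = 0) := by
    rcases mul_eq_zero.1 f1 with h | h
    · exact Or.inl h
    · right
      by_contra hcd
      have hd : d ≠ 0 := fun hd => hcd ⟨by rw [hd] at h; simpa using h, hd⟩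
      have h1 : ((1 : ℕ) : ℚ) * (c / d) ^ 2 = (2 : ℕ) := by
        field_simp; push_cast; linarith
      have := isSquare_mul_of_rat h1
      exact Nat.prime_two.prime.irreducible.not_isSquare (by simpa using this)
  have hq0 : ((p₁ * p₂ : ℕ) : ℚ) ≠ 0 := by
    have := Nat.mul_ne_zero hp₁.ne_zero hp₂.ne_zero
    exact_mod_cast this
  rcases hcd with rfl | ⟨rfl, rfl⟩
  · by_cases ha : a = 0
    · subst ha
      have : c * d = 0 := by
        have : ((p₁ * p₂ : ℕ) : ℚ) * (c * d) = 0 := by linear_combination e2 / 2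
        exact (mul_eq_zero.1 this).resolve_left hq0
      rcases mul_eq_zero.1 this with rfl | rfl
      · exact c4 d (by linear_combination e1)
      · exact c3 c (by linear_combination e1)
    · have hc : c = 0 := (mul_eq_zero.1 (by linear_combination e3 / 2 : a * c = 0)).resolve_left ha
      have hd : d = 0 := (mul_eq_zero.1 (by linear_combination e4 / 2 : a * d = 0)).resolve_left ha
      subst hc hd
      exact c1 a (by linear_combination e1)
  · rcases mul_eq_zero.1 (by linear_combination e2 / 2 : a * b = 0) with rfl | rfl
    · exact c2 b (by linear_combination e1)
    · exact c1 a (by linear_combination e1)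

/-- `8` times the product of `1 + u`, `a + v`, `R + uv` and `q + (a(R + S) + b(R - S))/2` is a
square, where `u² = 2`, `v² = q`, `a² + b² = q` and `R² + S² = 2q`. -/
lemma eight_mul_prod_eq_sq {A : Type*} [CommRing A] {a b R S u v q : A} (hu : u ^ 2 = 2)
    (hv : v ^ 2 = q) (hab : a ^ 2 + b ^ 2 = q) (hRS : R ^ 2 + S ^ 2 = 2 * q) :
    4 * ((1 + u) * (a + v) * (R + u * v)) * (2 * q + (a * (R + S) + b * (R - S))) =
      (a * R + b * R - b * S + a * S + u * (a * R - b * S) + v * (R + S) + u * v * (a + b) +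
        u * v * R + 2 * v * a + q * u + 2 * q) ^ 2 := by
  linear_combination (
       6 * v * a * q + 2 * v * a ^ 2 * R + 4 * v * S * a ^ 2 + 2 * v * b * a * R
      - 2 * v * b * S * a + 8 * v ^ 2 * q + 2 * v ^ 2 * a * R + 4 * v ^ 2 * S * a
      + 2 * v ^ 2 * b * R - 4 * v ^ 2 * b * S - a ^ 2 * R ^ 2 + 2 * b * S * a * R
      - 2 * v * a * R ^ 2 - 2 * a * R * q - b ^ 2 * S ^ 2 + 2 * v * b ^ 2 * S
      + 2 * v * b * S * R + 2 * b * S * q - v ^ 2 * a ^ 2 - 2 * v ^ 2 * b * a - v ^ 2 * b ^ 2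
      - 2 * v * b * q - v ^ 2 * R ^ 2 - 2 * v * R * q - q ^ 2) * hu +
    (
       8 * u * q - 2 * u * a * R + 2 * u * S * a + 2 * u * b * R - 6 * u * b * S - 3 * R ^ 2
      - 2 * S * R - 2 * u * R ^ 2 - S ^ 2 - 2 * u * S * R + 4 * S * a - 4 * u * a ^ 2
      - 4 * u * b * a - 6 * a ^ 2 + 16 * q + 4 * b * R - 8 * b * S - 4 * b * a - 2 * b ^ 2) * hv +
    (
       -1 * R ^ 2 + 2 * S * R + 2 * u * S * R - 2 * u * v * R - 3 * S ^ 2 - 2 * u * S ^ 2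
      + 2 * u * v * S + 4 * v * S - 2 * q) * hab +
    (
       2 * b * a + 2 * v * b + 2 * a ^ 2 + 2 * u * b * a - 2 * v * a + 2 * u * v * b - 4 * q
      - 2 * u * q + 2 * u * a ^ 2) * hRS

/-- In a field containing `√2`, the product of the three generators attached to a decomposition
`q = a² + b²`, `2q = R² + S²` is, up to squares, the rational number
`q + (a(R + S) + b(R - S))/2`. -/
lemma exists_sq_eq_iff_of_sum_sq {K : IntermediateField ℚ ℝ} {q : ℕ} (h2 : √2 ∈ K)
    (hq : √(q : ℝ) ∈ K) {a b R S r g : ℤ} (hab : a ^ 2 + b ^ 2 = q) (hRS : R ^ 2 + S ^ 2 = 2 * q)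
    (hb : b ≠ 0) (hS : S ≠ 0) (hR : R = S + 4 * r) (hg : g = q + a * (S + 2 * r) + 2 * b * r)
    (hg0 : 0 < g) {T k : ℝ} (hT : 0 < T) (hk : k ∈ K)
    (hkT : k ^ 2 = T * ((1 + √2) * (a + √q) * (R + √2 * √q))) :
    (∃ t ∈ K, t ^ 2 = T) ↔ ∃ t ∈ K, t ^ 2 = g := by
  have s2 : √2 ^ 2 = (2 : ℝ) := Real.sq_sqrt (by norm_num)
  have sq : √(q : ℝ) ^ 2 = q := Real.sq_sqrt (Nat.cast_nonneg _)
  have hab' : (a : ℝ) ^ 2 + b ^ 2 = q := by exact_mod_cast hab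
  have hRS' : (R : ℝ) ^ 2 + S ^ 2 = 2 * q := by exact_mod_cast hRS
  have hR' : (R : ℝ) = S + 4 * r := by exact_mod_cast hR
  have hg' : (g : ℝ) = q + a * (S + 2 * r) + 2 * b * r := by exact_mod_cast hg
  have hb' : 0 < (b : ℝ) ^ 2 := by have : (b : ℝ) ≠ 0 := by exact_mod_cast hb
                                   positivity
  have hS' : 0 < (S : ℝ) ^ 2 := by have : (S : ℝ) ≠ 0 := by exact_mod_cast hS
                                   positivity
  have h2pos : 0 < √(2 : ℝ) := by positivity
  have ha : 0 < a + √(q : ℝ) := by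
    have := abs_lt_of_sq_lt_sq (a := (a : ℝ)) (b := √(q : ℝ)) (by rw [sq]; linarith) (by positivity)
    linarith [(abs_lt.1 this).1]
  have hR0 : 0 < R + √2 * √(q : ℝ) := by
    have := abs_lt_of_sq_lt_sq (a := (R : ℝ)) (b := √2 * √(q : ℝ))
      (by rw [mul_pow, s2, sq]; linarith) (by positivity)
    linarith [(abs_lt.1 this).1]
  set P : ℝ := (1 + √2) * (a + √q) * (R + √2 * √q) with hP
  have hP0 : 0 < P := by positivity
  have hgR : 0 < (g : ℝ) := by exact_mod_cast hg0
  set e : ℝ := a * R + b * R - b * S + a * S + √2 * (a * R - b * S) + √q * (R + S) +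
    √2 * √q * (a + b) + √2 * √q * R + 2 * √q * a + q * √2 + 2 * q with he
  have heK : e ∈ K := by
    have hz : ∀ n : ℤ, (n : ℝ) ∈ K := fun n => intCast_mem K n
    have hn : ∀ n : ℕ, (n : ℝ) ∈ K := fun n => _root_.natCast_mem K n
    have hn2 : (2 : ℝ) ∈ K := by exact_mod_cast hn 2
    rw [he]
    repeat' first
      | exact hz _ | exact hn _ | exact hn2 | exact h2 | exact hq
      | apply add_mem | rw [sub_eq_add_neg] | apply neg_mem | apply mul_mem
  have heP : 8 * P * g = e ^ 2 := by
    have hG : 2 * (g : ℝ) = 2 * q + (a * (R + S) + b * (R - S)) := by rw [hg', hR']; ring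
    rw [show 8 * P * g = 4 * P * (2 * g) by ring, hG, hP, he,
      eight_mul_prod_eq_sq s2 sq hab' hRS']
  have he0 : e ≠ 0 := fun h => by
    rw [h] at heP
    have : 0 < 8 * P * g := by positivity
    simp [heP] at this
  have hk0 : k ≠ 0 := fun h => by
    rw [h] at hkT
    have : 0 < T * P := by positivity
    simp [← hkT] at this
  constructor
  · rintro ⟨t, ht, rfl⟩
    refine ⟨e * t / (√2 * √2 * √2 * k), ?_, ?_⟩
    · exact div_mem (mul_mem heK ht) (mul_mem (mul_mem (mul_mem h2 h2) h2) hk)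
    · rw [div_pow, div_eq_iff (by positivity), mul_pow, mul_pow, mul_pow, mul_pow, s2, hkT, ← heP]
      ring
  · rintro ⟨t, ht, htg⟩
    refine ⟨√2 * √2 * √2 * k * t / e, ?_, ?_⟩
    · exact div_mem (mul_mem (mul_mem (mul_mem (mul_mem h2 h2) h2) hk) ht) heK
    · rw [div_pow, div_eq_iff (by positivity), mul_pow, mul_pow, mul_pow, mul_pow, s2, htg, hkT,
        ← heP]
      ring

/-- An odd integer `g > 0` with `g(2p₁p₂ - g)` a square and `p₁ ∤ g` is `s²` or `p₂s²`. -/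
lemma eq_sq_or_eq_mul_sq {p₁ p₂ : ℕ} (hp₁ : p₁.Prime) (hp₂ : p₂.Prime) {g w : ℤ} (hg : 0 < g)
    (hodd : Odd g) (hp : ¬ (p₁ : ℤ) ∣ g) (hw : g * (2 * (p₁ * p₂) - g) = w ^ 2) :
    ∃ s : ℤ, g = s ^ 2 ∨ g = p₂ * s ^ 2 := by
  lift g to ℕ using hg.le
  obtain ⟨h, s, hs, hsf⟩ := Nat.sq_mul_squarefree g
  have hs0 : (s : ℤ) ≠ 0 := fun h0 => by
    rw [Nat.cast_eq_zero] at h0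
    rw [h0] at hs; simp at hs; omega
  have hsZ : (g : ℤ) = s ^ 2 * h := by rw [← hs]; push_cast; ring
  have hh0 : (h : ℤ) ≠ 0 := fun h0 => by
    rw [h0] at hsZ; simp at hsZ; omega
  obtain ⟨w', rfl⟩ : (s : ℤ) ∣ w := (Int.pow_dvd_pow_iff two_ne_zero).1
    ⟨h * (2 * (p₁ * p₂) - g), by rw [← hw]; nth_rewrite 1 [hsZ]; ring⟩
  have h1 : h * (2 * (p₁ * p₂) - g) = w' ^ 2 := by
    apply mul_left_cancel₀ (pow_ne_zero 2 hs0)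
    rw [← mul_assoc, ← hsZ, hw]; ring
  have hhw : (h : ℤ) ∣ w' :=
    ((Int.squarefree_natCast.2 hsf).dvd_pow_iff_dvd two_ne_zero).1 ⟨_, h1.symm⟩
  obtain ⟨v, rfl⟩ := hhw
  have h2 : 2 * (p₁ * p₂) - (g : ℤ) = h * v ^ 2 := by
    apply mul_left_cancel₀ hh0
    rw [h1]; ring
  have h3 : (h : ℤ) ∣ 2 * (p₁ * p₂) := ⟨v ^ 2 + s ^ 2, by linear_combination h2 + hsZ⟩
  have h3' : h ∣ 2 * (p₁ * p₂) := by exact_mod_cast h3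
  have hho : Odd h := by
    have : Odd (s ^ 2 * h) := by rw [hs]; exact_mod_cast hodd
    exact (Nat.odd_mul.1 this).2
  have h4 : h ∣ p₁ * p₂ := (Nat.Coprime.dvd_of_dvd_mul_left
    (Nat.coprime_two_right.2 hho) h3')
  have h5 : Nat.Coprime h p₁ := by
    rw [Nat.coprime_comm, hp₁.coprime_iff_not_dvd]
    intro hd
    exact hp (hsZ ▸ Dvd.dvd.mul_left (by exact_mod_cast hd) _)
  rcases (Nat.dvd_prime hp₂).1 (h5.dvd_of_dvd_mul_left h4) with rfl | rfl
  · exact ⟨s, Or.inl (by rw [hsZ]; simp)⟩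
  · exact ⟨s, Or.inr (by rw [hsZ]; ring)⟩

lemma sum_sq_combination_cases {p₁ p₂ : ℕ} (hp₁ : p₁.Prime) (hp₂ : p₂.Prime) (h₁ : p₁ ≠ 2)
    (hs : J(p₂ | p₁) = -1) {a b R S r g : ℤ} (hab : a ^ 2 + b ^ 2 = p₁ * p₂)
    (hRS : R ^ 2 + S ^ 2 = 2 * (p₁ * p₂)) (hR : R = S + 4 * r)
    (hbp : J(b | p₁) = 1) (hSp : J(S | p₁) = 1) (hd : (p₁ : ℤ) ∣ a * S - b * R)
    (hg : g = p₁ * p₂ + a * (S + 2 * r) + 2 * b * r) (hodd : Odd g) :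
    0 < g ∧ ∃ s : ℤ, (J(R - S | p₁) = 1 ∧ g = s ^ 2) ∨ (J(R - S | p₁) = -1 ∧ g = p₂ * s ^ 2) := by
  have hq : (S + 2 * r) ^ 2 + 4 * r ^ 2 = p₁ * p₂ := by
    subst hR; linarith
  have hw : g * (2 * (p₁ * p₂) - g) = (b * (S + 2 * r) - 2 * a * r) ^ 2 := by
    rw [hg]
    linear_combination (-(S + 2 * r) ^ 2 - 4 * r ^ 2) * hab - (p₁ * p₂ : ℤ) * hq
  have hp : Prime (p₁ : ℤ) := Nat.prime_iff_prime_int.1 hp₁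
  have hp2 : ¬ (p₁ : ℤ) ∣ 2 := fun h =>
    h₁ ((Nat.prime_dvd_prime_iff_eq hp₁ Nat.prime_two).1 (by exact_mod_cast h))
  have hpS : ¬ (p₁ : ℤ) ∣ S := not_dvd_of_jacobiSym_ne_zero hp₁ (by rw [hSp]; norm_num)
  have hpb : ¬ (p₁ : ℤ) ∣ b := not_dvd_of_jacobiSym_ne_zero hp₁ (by rw [hbp]; norm_num)
  have hpq : (p₁ : ℤ) ∣ p₁ * p₂ := dvd_mul_right _ _
  have hgb : (p₁ : ℤ) ∣ g - b * (R - S) := by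
    have h : (p₁ : ℤ) ∣ 2 * S * (g - b * (R - S)) := by
      obtain ⟨m, hm⟩ := hd
      refine ⟨p₂ * (2 * S + 2 * b) + m * (R + S), ?_⟩
      rw [hg]
      subst hR
      linear_combination (2 * S + 4 * r) * hm + b * hRS
    rcases hp.dvd_or_dvd h with h | h
    · exact absurd h fun h => (hp.dvd_or_dvd h).elim hp2 hpS
    · exact h
  have hRSp : ¬ (p₁ : ℤ) ∣ R - S := fun h => by
    have h1 : (p₁ : ℤ) ∣ 2 * (S * S) := by
      rw [show 2 * (S * S) = 2 * (p₁ * p₂) - (R + S) * (R - S) by linear_combination hRS]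
      exact (hpq.mul_left 2).sub (h.mul_left (R + S))
    rcases hp.dvd_or_dvd h1 with h | h
    · exact hp2 h
    · exact (hp.dvd_or_dvd h).elim hpS hpS
  have hpg : ¬ (p₁ : ℤ) ∣ g := fun h => by
    have := (dvd_sub_right h).1 hgb
    exact (hp.dvd_or_dvd this).elim hpb hRSp
  have hJ : J(g | p₁) = J(R - S | p₁) := by
    rw [jacobiSym_congr hgb, jacobiSym.mul_left, hbp, one_mul]
  have hg0 : 0 < g := by
    have hq0 : (0 : ℤ) < p₁ * p₂ := by
      have := hp₁.pos; have := hp₂.pos; positivity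
    have hne : g ≠ 0 := fun h => hpg (h ▸ dvd_zero _)
    by_contra hlt
    have : g < 0 := lt_of_le_of_ne (not_lt.1 hlt) hne
    nlinarith [sq_nonneg (b * (S + 2 * r) - 2 * a * r)]
  refine ⟨hg0, ?_⟩
  obtain ⟨s, hs' | hs'⟩ := eq_sq_or_eq_mul_sq hp₁ hp₂ hg0 hodd hpg hw
  all_goals
    have hps : IsCoprime s p₁ := isCoprime_of_not_dvd hp₁ fun h =>
      hpg (hs' ▸ by first | exact dvd_pow h two_ne_zero | exact (dvd_pow h two_ne_zero).mul_left _)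
    have hss : J(s ^ 2 | p₁) = 1 := jacobiSym.sq_one' (Int.isCoprime_iff_gcd_eq_one.1 hps)
    refine ⟨s, ?_⟩
  · exact Or.inl ⟨by rw [← hJ, hs', hss], hs'⟩
  · exact Or.inr ⟨by rw [← hJ, hs', jacobiSym.mul_left, hs, hss, mul_one], hs'⟩

lemma Nat.Prime.mod_eight_eq_five {p : ℕ} (hp : p.Prime) (hm : p % 4 = 1)
    (h2 : ¬ IsSquare (2 : ZMod p)) : p % 8 = 5 := by
  have := Fact.mk hp
  by_contra h
  exact h2 ((ZMod.exists_sq_eq_two_iff (by rintro rfl; omega)).2 (by omega))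

/-- Let `p₁ ≡ p₂ ≡ 1 (mod 4)` be distinct primes with Legendre symbols
`(2/p₁) = (2/p₂) = (p₁/p₂) = -1` (encoded by non-residue conditions).  Then
`ε₂·ε_{p₁p₂}·ε_{2p₁p₂}` is a square in `ℚ(√2, √(p₁p₂))` if and only if
`(p₁p₂/2)₄·(2p₁/p₂)₄·(2p₂/p₁)₄ = -1`, where `(p₁p₂/2)₄ = (-1)^((p₁p₂-1)/8)` and
`c = (2p₁/p₂)₄`, `d = (2p₂/p₁)₄` are the rational quartic residue symbols. -/
theorem stmt_14 (p₁ p₂ : ℕ) (hp₁ : p₁.Prime) (hp₂ : p₂.Prime) (hne : p₁ ≠ p₂)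
    (hm₁ : p₁ % 4 = 1) (hm₂ : p₂ % 4 = 1)
    (h2p₁ : ¬ IsSquare (2 : ZMod p₁)) (h2p₂ : ¬ IsSquare (2 : ZMod p₂))
    (hp₁p₂ : ¬ IsSquare ((p₁ : ZMod p₂)))
    (ε₂ εp εd : ℝ)
    (hε₂ : IsFundUnit 2 ε₂) (hεp : IsFundUnit (p₁ * p₂) εp) (hεd : IsFundUnit (2 * p₁ * p₂) εd)
    (c d : ℤ) (hc : c = 1 ∨ c = -1) (hd : d = 1 ∨ d = -1)
    (hccong : (c : ZMod p₂) = ((2 * p₁ : ℕ) : ZMod p₂) ^ ((p₂ - 1) / 4))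
    (hdcong : (d : ZMod p₁) = ((2 * p₂ : ℕ) : ZMod p₁) ^ ((p₁ - 1) / 4)) :
    (∃ t : ℝ, t ∈ ℚ⟮Real.sqrt 2, Real.sqrt ((p₁ : ℝ) * p₂)⟯ ∧ t ^ 2 = ε₂ * εp * εd) ↔
      (-1 : ℤ) ^ ((p₁ * p₂ - 1) / 8) * c * d = -1 := by
  have h5₁ := hp₁.mod_eight_eq_five hm₁ h2p₁
  have h5₂ := hp₂.mod_eight_eq_five hm₂ h2p₂
  have hs : J(p₁ | p₂) = -1 := by
    have := Fact.mk hp₂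
    exact ZMod.nonsquare_iff_jacobiSym_eq_neg_one.2 (by exact_mod_cast hp₁p₂)
  have hs' : J(p₂ | p₁) = -1 := by
    rw [jacobiSym.quadratic_reciprocity_one_mod_four hm₂ (Nat.odd_iff.2 (by omega)), hs]
  have hq8 : p₁ * p₂ % 8 = 1 := by rw [Nat.mul_mod, h5₁, h5₂]
  have hz₂ : (p₂ : ℤ) % 8 = 5 := by omega
  have hn₁ : p₁ ≠ 2 := by rintro rfl; omega
  have hn₂ : p₂ ≠ 2 := by rintro rfl; omega
  rw [← Nat.cast_mul]
  set K := ℚ⟮√2, √((p₁ * p₂ : ℕ) : ℝ)⟯ with hK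
  have k2 : √2 ∈ K := subset_adjoin ℚ _ (by simp)
  have kq : √((p₁ * p₂ : ℕ) : ℝ) ∈ K := subset_adjoin ℚ _ (by simp)
  have hsd : √((2 * p₁ * p₂ : ℕ) : ℝ) = √2 * √((p₁ * p₂ : ℕ) : ℝ) := by
    rw [← Real.sqrt_mul (by norm_num)]
    push_cast
    rw [mul_assoc]
  obtain ⟨R₂, S₂, h1, h2, -, hk₂⟩ := hε₂.exists_sum_sq (Or.inr rfl) fun d₁ d₂ h h1 h2 => by
    have := (Nat.dvd_prime Nat.prime_two).1 ⟨d₂, h⟩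
    rcases this with rfl | rfl
    · exact absurd rfl h1
    · exact absurd (by omega) h2
  obtain ⟨a₀, b, hab₀, hb, hbJ, hka⟩ := hεp.exists_sum_sq (Or.inl hq8) fun d₁ d₂ h =>
    mul_sq_add_one_ne_of_factor hp₁ hp₂ h5₁ h5₂ hs (one_dvd 2) (by rw [one_mul, h])
  obtain ⟨R₀, S, hRS₀, hS, hSJ, hkR⟩ := hεd.exists_sum_sq
    (Or.inr (by rw [mul_assoc, Nat.mul_mod, hq8])) fun d₁ d₂ h =>
    mul_sq_add_one_ne_of_factor hp₁ hp₂ h5₁ h5₂ hs dvd_rfl h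
  have hR₂ : R₂ = 1 ∨ R₂ = -1 := by
    have h3 : R₂ ^ 2 ≤ 2 := by rw [Nat.cast_ofNat] at h1; nlinarith [sq_nonneg S₂]
    have h4 : R₂ ≤ 1 := by nlinarith
    have h5 : -1 ≤ R₂ := by nlinarith
    rcases (by omega : R₂ = 1 ∨ R₂ = -1 ∨ R₂ = 0) with h | h | h
    · exact Or.inl h
    · exact Or.inr h
    · subst h
      obtain ⟨m, rfl⟩ := h2
      push_cast at h1
      ring_nf at h1
      omega
  obtain ⟨k₁, hk₁, e₁⟩ := hk₂ K (by exact_mod_cast k2) R₂ hR₂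
  have e₁' : k₁ ^ 2 = ε₂ * (1 + √2) := by
    rw [e₁]
    rcases hR₂ with rfl | rfl <;> norm_num
  have hRS₁ : R₀ ^ 2 + S ^ 2 = 2 * (p₁ * p₂) := by rw [hRS₀]; push_cast; ring
  have hab₁ : a₀ ^ 2 + b ^ 2 = p₁ * p₂ := by rw [hab₀]; push_cast; ring
  have hq1 : (p₁ * p₂ : ℤ) % 8 = 1 := by exact_mod_cast hq8
  obtain ⟨σ, hσ, r, hr⟩ : ∃ σ : ℤ, (σ = 1 ∨ σ = -1) ∧ ∃ r, σ * R₀ = S + 4 * r := by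
    have hR0 : Odd R₀ := by
      by_contra he
      obtain ⟨m, rfl⟩ := even_iff_two_dvd.1 (Int.not_odd_iff_even.1 he)
      obtain ⟨n, rfl⟩ := hS
      ring_nf at hRS₁
      omega
    obtain ⟨m, rfl⟩ := hR0
    obtain ⟨n, rfl⟩ := hS
    rcases Int.even_or_odd' (m - n) with ⟨t, ht | ht⟩
    · exact ⟨1, Or.inl rfl, t, by linear_combination 2 * ht⟩
    · exact ⟨-1, Or.inr rfl, -t - 1 - n, by linear_combination -2 * ht⟩
  obtain ⟨R, hRdef⟩ : ∃ R, R = σ * R₀ := ⟨_, rfl⟩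
  rw [← hRdef] at hr
  have hRS : R ^ 2 + S ^ 2 = 2 * (p₁ * p₂) := by
    rw [hRdef, ← hRS₁]; rcases hσ with rfl | rfl <;> ring
  obtain ⟨ρ, hρ, hdiv⟩ : ∃ ρ : ℤ, (ρ = 1 ∨ ρ = -1) ∧ (p₁ : ℤ) ∣ ρ * a₀ * S - b * R := by
    have h : (p₁ : ℤ) ∣ (1 * a₀ * S - b * R) * (-1 * a₀ * S - b * R) :=
      ⟨p₂ * (2 * b ^ 2 - S ^ 2), by linear_combination -S ^ 2 * hab₁ + b ^ 2 * hRS⟩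
    rcases (Nat.prime_iff_prime_int.1 hp₁).dvd_or_dvd h with h | h
    · exact ⟨1, Or.inl rfl, h⟩
    · exact ⟨-1, Or.inr rfl, h⟩
  obtain ⟨a, hadef⟩ : ∃ a, a = ρ * a₀ := ⟨_, rfl⟩
  rw [← hadef] at hdiv
  have hab : a ^ 2 + b ^ 2 = p₁ * p₂ := by
    rw [hadef, ← hab₁]; rcases hρ with rfl | rfl <;> ring
  have hodd : Odd (p₁ * p₂ + a * (S + 2 * r) + 2 * b * r) := by
    have ha : Even a := by
      by_contra he
      obtain ⟨m, rfl⟩ := Int.not_even_iff_odd.1 he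
      obtain ⟨n, rfl⟩ := hb
      ring_nf at hab
      omega
    obtain ⟨m, rfl⟩ := even_iff_two_dvd.1 ha
    have hqo : Odd (p₁ * p₂ : ℤ) := Int.odd_iff.2 (by omega)
    rw [add_assoc]
    exact hqo.add_even ⟨m * (S + 2 * r) + b * r, by ring⟩
  have hbJ₁ := hbJ p₁ hp₁ (dvd_mul_right _ _)
  have hSJ₁ := hSJ p₁ hp₁ ⟨2 * p₂, by ring⟩
  obtain ⟨hg0, s, hcase⟩ := sum_sq_combination_cases hp₁ hp₂ hn₁ hs' hab hRS hr hbJ₁ hSJ₁ hdiv rfl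
    hodd
  obtain ⟨k₂, hk₂, e₂⟩ := hka K kq ρ hρ
  obtain ⟨k₃, hk₃, e₃⟩ := hkR K (hsd ▸ mul_mem k2 kq) σ hσ
  have hεpos : ∀ {D : ℕ} {ε : ℝ}, IsFundUnit D ε → 0 < ε := fun h => one_pos.trans h.1
  have hT : 0 < ε₂ * εp * εd := mul_pos (mul_pos (hεpos hε₂) (hεpos hεp)) (hεpos hεd)
  have hb0 : b ≠ 0 := by rintro rfl; exact absurd hb (by decide)
  have hS0 : S ≠ 0 := by rintro rfl; exact absurd hS (by decide)
  have hiff := exists_sq_eq_iff_of_sum_sq (K := K) (q := p₁ * p₂) k2 kq (by push_cast; exact hab)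
    (by push_cast; exact hRS) hb0 hS0 hr (g := p₁ * p₂ + a * (S + 2 * r) + 2 * b * r)
    (by push_cast; ring) hg0 hT (mul_mem (mul_mem hk₁ hk₂) hk₃) (by
      rw [mul_pow, mul_pow, e₁', e₂, e₃, hsd, hadef, hRdef]
      push_cast
      ring)
  rw [quartic_symbol_product hp₁ hp₂ hne h5₁ h5₂ hs (by rw [hRS]; ring) hS hr hSJ₁
    (hSJ p₂ hp₂ (dvd_mul_left _ _)) hc hd hccong hdcong]
  refine hiff.trans ?_
  rcases hcase with ⟨hJ, hg⟩ | ⟨hJ, hg⟩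
  · rw [hJ, hg]
    exact iff_of_true ⟨s, intCast_mem K s, by push_cast; rfl⟩ rfl
  · rw [hJ]
    refine iff_of_false ?_ (by norm_num)
    rintro ⟨t, ht, htg⟩
    have hs0 : (s : ℝ) ≠ 0 := fun h => by
      rw [Int.cast_eq_zero.1 h] at hg
      rw [hg] at hg0; simp at hg0
    refine sq_ne_prime_of_mem_adjoin hp₁ hp₂ hne hn₁ hn₂ (t := t / s)
      (div_mem ht (intCast_mem K s)) ?_
    rw [div_pow, htg, hg, div_eq_iff (by positivity)]
    push_cast
    rfl
end

section
/- Let p₁ and p₂ be distinct primes with p₁ ≡ p₂ ≡ 1 (mod 4) such that the Legendre symbols satisfy (2/p₁) = (2/p₂) = (p₁/p₂). Then (p₁p₂/2)₄·(2p₁/p₂)₄·(2p₂/p₁)₄ = (π₁/π₃)·((1+i)/π₁)·((1+i)/π₃). -/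
open NumberField IntermediateField

/-- The residue map of a Gaussian prime of prime norm `p`. -/
theorem GaussianInt.exists_residueHom (p : ℕ) [Fact p.Prime] (π : GaussianInt)
    (hπ : π.norm = p) :
    ∃ φ : GaussianInt →+* ZMod p, Function.Surjective φ ∧ ∀ z, φ z = 0 ↔ π ∣ z := by
  obtain ⟨x, y⟩ := π
  have hp : (p : ℤ) = x ^ 2 + y ^ 2 := by rw [← hπ, Zsqrtd.norm_def]; ring
  have hpp : Prime (p : ℤ) := Nat.prime_iff_prime_int.mp (Fact.out : p.Prime)
  have hy : (y : ZMod p) ≠ 0 := by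
    intro h
    rw [ZMod.intCast_zmod_eq_zero_iff_dvd] at h
    have hx : (p : ℤ) ∣ x := by
      refine hpp.dvd_of_dvd_pow (n := 2) ?_
      rw [show x ^ 2 = p - y * y by rw [hp]; ring]
      exact dvd_sub dvd_rfl (h.mul_right y)
    obtain ⟨a, rfl⟩ := h
    obtain ⟨b, rfl⟩ := hx
    refine hpp.not_isUnit (IsUnit.of_mul_eq_one (b ^ 2 + a ^ 2) ?_)
    exact mul_left_cancel₀ hpp.ne_zero (by linear_combination -hp)
  have hxy : (x : ZMod p) ^ 2 + (y : ZMod p) ^ 2 = 0 := by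
    have := congrArg (Int.cast : ℤ → ZMod p) hp
    push_cast at this
    rw [← this, ZMod.natCast_self]
  let r : {r : ZMod p // r * r = ((-1 : ℤ) : ZMod p)} := ⟨-x / y, by
    field_simp
    push_cast
    linear_combination hxy⟩
  have hr (z : GaussianInt) : Zsqrtd.lift r z = z.re + z.im * (-x / y : ZMod p) := rfl
  refine ⟨Zsqrtd.lift r, fun a ↦ ?_, fun z ↦ ⟨fun h ↦ ?_, ?_⟩⟩
  · obtain ⟨n, rfl⟩ := ZMod.intCast_surjective a
    exact ⟨n, by simp⟩
  · obtain ⟨a, b⟩ := z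
    rw [hr] at h
    have h1 : (a : ZMod p) * y - b * x = 0 := by
      have : ((a : ZMod p) + b * (-x / y)) * y = 0 := by
        rw [show (a : ZMod p) + b * (-x / y) = 0 from h, zero_mul]
      field_simp at this
      linear_combination this
    have h2 : (a : ZMod p) * x + b * y = 0 := by
      have : (y : ZMod p) * (a * x + b * y) = 0 := by linear_combination (x : ZMod p) * h1 + b * hxy
      exact (mul_eq_zero.mp this).resolve_left hy
    have h1' : (p : ℤ) ∣ a * y - b * x := by
      rw [← ZMod.intCast_zmod_eq_zero_iff_dvd]; exact_mod_cast h1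
    have h2' : (p : ℤ) ∣ a * x + b * y := by
      rw [← ZMod.intCast_zmod_eq_zero_iff_dvd]; exact_mod_cast h2
    obtain ⟨u, hu⟩ := h1'
    obtain ⟨v, hv⟩ := h2'
    refine ⟨⟨v, -u⟩, ?_⟩
    have ha : a = x * v + -1 * y * -u :=
      mul_left_cancel₀ hpp.ne_zero (by linear_combination a * hp + x * hv + y * hu)
    have hb : b = x * -u + y * v :=
      mul_left_cancel₀ hpp.ne_zero (by linear_combination b * hp + y * hv - x * hu)
    exact Zsqrtd.ext ha hb
  · rintro ⟨w, rfl⟩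
    rw [map_mul]
    have : Zsqrtd.lift r (⟨x, y⟩ : GaussianInt) = 0 := by
      rw [hr]
      field_simp
      ring
    rw [this, zero_mul]

theorem isSquare_quotient_mk_span_iff {R S : Type*} [CommRing R] [CommRing S] {φ : R →+* S}
    (hφ : Function.Surjective φ) {π : R} (hπ : ∀ z, φ z = 0 ↔ π ∣ z) (a : R) :
    IsSquare (Ideal.Quotient.mk (Ideal.span {π}) a) ↔ IsSquare (φ a) := by
  constructor
  · rintro ⟨r, hr⟩
    obtain ⟨b, rfl⟩ := Ideal.Quotient.mk_surjective r
    rw [← map_mul, Ideal.Quotient.eq, Ideal.mem_span_singleton, ← hπ, map_sub, sub_eq_zero,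
      map_mul] at hr
    exact ⟨_, hr⟩
  · rintro ⟨r, hr⟩
    obtain ⟨b, rfl⟩ := hφ r
    refine ⟨Ideal.Quotient.mk _ b, ?_⟩
    rw [← map_mul, Ideal.Quotient.eq, Ideal.mem_span_singleton, ← hπ, map_sub, sub_eq_zero,
      map_mul, hr]

theorem ZMod.intCast_eq_pow_half_of_isSquare_iff {p : ℕ} [Fact p.Prime] {a : ZMod p}
    (ha : a ≠ 0) {s : ℤ} (hs : s = 1 ∨ s = -1) (h : s = 1 ↔ IsSquare a) :
    (s : ZMod p) = a ^ (p / 2) := by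
  rw [ZMod.euler_criterion p ha] at h
  rcases ZMod.pow_div_two_eq_neg_one_or_one p ha with h1 | h1
  · rw [h1, h.mpr h1, Int.cast_one]
  · rcases hs with rfl | rfl
    · rw [h.mp rfl, Int.cast_one]
    · rw [h1]; simp

namespace GaussianInt

/-- The imaginary unit as a Gaussian integer. -/
def I : GaussianInt := ⟨0, 1⟩

theorem I_sq : I ^ 2 = -1 := by decide

theorem I_pow_four : I ^ 4 = 1 := by decide

theorem isPrimitiveRoot_I : IsPrimitiveRoot I 4 :=
  IsPrimitiveRoot.mk_of_lt I (by norm_num) I_pow_four fun l h0 h4 ↦ by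
    interval_cases l <;> decide

theorem eq_unit_of_norm_eq_one {z : GaussianInt} (hz : z.norm = 1) :
    z = 1 ∨ z = -1 ∨ z = I ∨ z = -I := by
  obtain ⟨x, y⟩ := z
  have h : x * x + y * y = 1 := by rw [← hz, Zsqrtd.norm_def]; ring
  have hx : x ≤ 1 := by nlinarith
  have hx' : -1 ≤ x := by nlinarith
  have hy : y ≤ 1 := by nlinarith
  have hy' : -1 ≤ y := by nlinarith
  interval_cases x <;> interval_cases y <;> first | omega | decide

section residue

variable {p : ℕ} [Fact p.Prime]

theorem exists_quartic_mulChar (hp : p % 4 = 1) (φ : GaussianInt →+* ZMod p) :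
    ∃ χ : MulChar (ZMod p) GaussianInt, ∀ a, φ (χ a) = a ^ ((p - 1) / 4) := by
  have hp1 := (Fact.out : p.Prime).one_lt
  have hcard : Fintype.card (ZMod p)ˣ = p - 1 := ZMod.card_units p
  obtain ⟨g, hg⟩ := IsCyclic.exists_generator (α := (ZMod p)ˣ)
  have hg4 : ((g : ZMod p) ^ ((p - 1) / 4)) ^ 4 = 1 := by
    rw [← pow_mul, Nat.div_mul_cancel (by omega), ← Units.val_pow_eq_pow_val,
      ZMod.units_pow_card_sub_one_eq_one, Units.val_one]
  have hI : φ I ^ 2 = -1 := by rw [← map_pow, I_sq, map_neg, map_one]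
  have hu : ∃ u : GaussianIntˣ, u ^ 4 = 1 ∧ φ u = (g : ZMod p) ^ ((p - 1) / 4) := by
    set t := (g : ZMod p) ^ ((p - 1) / 4)
    have ht : (t - 1) * ((t + 1) * ((t - φ I) * (t + φ I))) = 0 := by
      linear_combination hg4 - (t ^ 2 - 1) * hI
    have hIu : I * -I = 1 := by decide
    rcases mul_eq_zero.mp ht with h | h
    · exact ⟨1, by simp, by simp [sub_eq_zero.mp h]⟩
    rcases mul_eq_zero.mp h with h | h
    · exact ⟨-1, by norm_num, by simp [eq_neg_of_add_eq_zero_left h]⟩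
    rcases mul_eq_zero.mp h with h | h
    · exact ⟨⟨I, -I, hIu, by decide⟩, Units.ext (by simpa using I_pow_four),
        (sub_eq_zero.mp h).symm⟩
    · exact ⟨⟨-I, I, by decide, by decide⟩, Units.ext (by simpa using (by decide : (-I) ^ 4 = 1)),
        by simp [eq_neg_of_add_eq_zero_left h]⟩
  obtain ⟨u, hu4, hu⟩ := hu
  have hmem : u ∈ rootsOfUnity (Fintype.card (ZMod p)ˣ) GaussianInt := by
    rw [mem_rootsOfUnity, hcard, show p - 1 = 4 * ((p - 1) / 4) by omega, pow_mul, hu4, one_pow]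
  refine ⟨MulChar.ofRootOfUnity hmem hg, fun a ↦ ?_⟩
  rcases eq_or_ne a 0 with rfl | ha
  · have : 5 ≤ p := by by_contra!; interval_cases p <;> omega
    rw [MulChar.map_zero, map_zero, zero_pow (by omega)]
  · obtain ⟨k, hk⟩ := mem_powers_iff_mem_zpowers.mpr (hg (Units.mk0 a ha))
    replace hk : a = (g : ZMod p) ^ k := by simpa using (congrArg Units.val hk).symm
    rw [hk, map_pow, MulChar.ofRootOfUnity_spec, map_pow, hu, ← pow_mul, ← pow_mul, mul_comm]

variable {φ : GaussianInt →+* ZMod p} {χ : MulChar (ZMod p) GaussianInt}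

theorem map_mulChar_pow_two (hp : p % 4 = 1) (hχ : ∀ a, φ (χ a) = a ^ ((p - 1) / 4)) (a : ZMod p) :
    φ (χ a) ^ 2 = a ^ (p / 2) := by
  rw [hχ, ← pow_mul]
  congr 1
  omega

theorem mulChar_sq_ne_one (hp : p % 4 = 1) (hχ : ∀ a, φ (χ a) = a ^ ((p - 1) / 4)) :
    χ ^ 2 ≠ 1 := by
  intro h
  obtain ⟨a, ha⟩ := FiniteField.exists_nonsquare (F := ZMod p)
    (by rw [ZMod.ringChar_zmod_n]; rintro rfl; omega)
  have ha0 : a ≠ 0 := by rintro rfl; exact ha (IsSquare.zero)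
  refine ha ((ZMod.euler_criterion p ha0).mpr ?_)
  rw [← map_mulChar_pow_two hp hχ, ← map_pow, ← MulChar.pow_apply' χ two_ne_zero, h,
    MulChar.one_apply (IsUnit.mk0 a ha0), map_one]

theorem norm_mulChar_apply {a : ZMod p} (ha : a ≠ 0) : (χ a).norm = 1 := by
  have : IsUnit (χ a) := (IsUnit.mk0 a ha).map χ
  rw [← Zsqrtd.norm_eq_one_iff' (by norm_num)] at this
  exact this

theorem mulChar_pow_four : χ ^ 4 = 1 := by
  refine MulChar.ext fun a ↦ ?_
  rw [MulChar.pow_apply_coe, MulChar.one_apply_coe]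
  rcases eq_unit_of_norm_eq_one (norm_mulChar_apply (χ := χ) a.ne_zero) with h | h | h | h <;>
    rw [h] <;> decide

theorem map_jacobiSum_eq_zero (hp : p % 4 = 1) (hχ : ∀ a, φ (χ a) = a ^ ((p - 1) / 4)) :
    φ (jacobiSum χ χ) = 0 := by
  have hp1 := (Fact.out : p.Prime).one_lt
  simp only [jacobiSum, map_sum, map_mul, hχ]
  set k := (p - 1) / 4 with hk
  have h (x : ZMod p) : x ^ k * (1 - x) ^ k =
      ∑ j ∈ Finset.range (k + 1), (-1) ^ j * (k.choose j : ZMod p) * x ^ (k + j) := by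
    rw [show 1 - x = -x + 1 by ring, add_pow, Finset.mul_sum]
    refine Finset.sum_congr rfl fun j _ ↦ ?_
    rw [neg_pow, pow_add]
    ring
  simp_rw [h]
  rw [Finset.sum_comm]
  refine Finset.sum_eq_zero fun j hj ↦ ?_
  rw [← Finset.mul_sum, FiniteField.sum_pow_lt_card_sub_one, mul_zero]
  rw [ZMod.card]
  rw [Finset.mem_range] at hj
  omega

theorem norm_jacobiSum (hχ : χ ^ 2 ≠ 1) : (jacobiSum χ χ).norm = p := by
  have hinj := toComplex_injective
  set χ' := χ.ringHomComp toComplex with hχ'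
  have h2 : χ' * χ' ≠ 1 := by
    rw [← sq, hχ', MulChar.ringHomComp_pow]
    exact (MulChar.ringHomComp_ne_one_iff hinj).mpr hχ
  have h1 : χ' ≠ 1 := by
    intro h; rw [h, one_mul] at h2; exact h2 rfl
  have key := jacobiSum_mul_jacobiSum_inv (F := ZMod p) (F' := ℂ) (by
    rw [ZMod.ringChar_zmod_n, ringChar.eq_zero]
    exact (Fact.out : p.Prime).ne_zero.symm) h1 h1 h2
  have hstar : jacobiSum χ'⁻¹ χ'⁻¹ = star (jacobiSum χ' χ') := by
    simp only [jacobiSum, star_sum, star_mul, MulChar.star_apply', mul_comm]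
  rw [hstar, jacobiSum_ringHomComp, ZMod.card] at key
  have := intCast_complex_norm (jacobiSum χ χ)
  rw [Complex.normSq_eq_conj_mul_self, mul_comm] at this
  have h3 := this.trans key
  exact_mod_cast h3

theorem two_dvd_im_jacobiSum (hp : p % 4 = 1) (χ : MulChar (ZMod p) GaussianInt) :
    2 ∣ (jacobiSum χ χ).im := by
  obtain ⟨z, -, hz⟩ := exists_jacobiSum_eq_neg_one_add (n := 4) (by norm_num)
    (mulChar_pow_four (χ := χ)) (mulChar_pow_four (χ := χ))
    (by rw [ZMod.card]; omega) isPrimitiveRoot_I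
  rw [hz]
  have : (I - 1) ^ 2 = ⟨0, -2⟩ := by decide
  rw [this]
  exact ⟨-z.re, by simp; ring⟩

/-- The Jacobi sum `J(χ, χ)` of the quartic residue character `χ` modulo a Gaussian prime `π` with
even imaginary part is `±π`. -/
theorem jacobiSum_eq_or_neg (hp : p % 4 = 1) (hχ : ∀ a, φ (χ a) = a ^ ((p - 1) / 4))
    {π : GaussianInt} (hπ : π.norm = p) (him : 2 ∣ π.im) (hφ : ∀ z, φ z = 0 ↔ π ∣ z) :
    jacobiSum χ χ = π ∨ jacobiSum χ χ = -π := by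
  obtain ⟨q, hq⟩ := (hφ _).mp (map_jacobiSum_eq_zero hp hχ)
  have hn := norm_jacobiSum (mulChar_sq_ne_one hp hχ)
  have h2 := two_dvd_im_jacobiSum hp χ
  have hp0 : (p : ℤ) ≠ 0 := by exact_mod_cast (Fact.out : p.Prime).ne_zero
  have hq1 : q.norm = 1 := by
    rw [hq, Zsqrtd.norm_mul, hπ] at hn
    exact mul_left_cancel₀ hp0 (hn.trans (mul_one _).symm)
  have hre : ¬ 2 ∣ π.re := by
    rintro ⟨a, ha⟩
    obtain ⟨b, hb⟩ := him
    rw [Zsqrtd.norm_def, ha, hb] at hπ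
    have : (p : ℤ) % 4 = 1 := by omega
    have : (p : ℤ) = 4 * (a * a + b * b) := by rw [← hπ]; ring
    omega
  rw [hq] at h2 ⊢
  rcases eq_unit_of_norm_eq_one hq1 with rfl | rfl | rfl | rfl
  · simp
  · simp
  · simp [I] at h2; exact absurd h2 hre
  · simp [I] at h2; exact absurd h2 hre

/-- The fourth power of a quartic Gauss sum. -/
theorem _root_.gaussSum_pow_four {F F' : Type*} [Field F] [Fintype F] [CommRing F'] [IsDomain F']
    {χ : MulChar F F'} (h2 : χ ^ 2 ≠ 1) (h4 : χ ^ 4 = 1) {ψ : AddChar F F'} (hψ : ψ.IsPrimitive) :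
    gaussSum χ ψ ^ 4 = jacobiSum χ χ ^ 2 * Fintype.card F := by
  have h := jacobiSum_mul_nontrivial (χ := χ) (φ := χ) (by rwa [← sq]) ψ
  have hq : gaussSum (χ ^ 2) ψ ^ 2 = Fintype.card F := by
    have hinv : (χ ^ 2)⁻¹ = χ ^ 2 := inv_eq_of_mul_eq_one_left (by rw [← pow_add, h4])
    have h1 : (χ ^ 2) (-1) = 1 := by
      rw [MulChar.pow_apply' _ two_ne_zero, ← map_pow, neg_one_sq, map_one]
    have := gaussSum_mul_gaussSum_eq_card h2 hψ
    rw [hinv] at this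
    have h' := mul_gaussSum_inv_eq_gaussSum (χ ^ 2) ψ
    rw [h1, one_mul] at h'
    rwa [h', ← sq] at this
  rw [← sq] at h
  rw [← hq, ← mul_pow, mul_comm, h]
  ring

/-- A rational form of quartic reciprocity for the quartic residue character modulo a Gaussian
prime `π` of norm `p`, evaluated at a rational prime `q ≡ 1 (mod 4)`. -/
theorem map_mulChar_mul_eq_one {q : ℕ} [Fact q.Prime] (hp : p % 4 = 1) (hq : q % 4 = 1)
    (hpq : p ≠ q) (hχ : ∀ a, φ (χ a) = a ^ ((p - 1) / 4)) {π : GaussianInt} (hπ : π.norm = p)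
    (him : 2 ∣ π.im) (hφ : ∀ z, φ z = 0 ↔ π ∣ z) (θ : GaussianInt →+* ZMod q) :
    θ (χ q) * (θ π ^ (q / 2) * (p : ZMod q) ^ ((q - 1) / 4)) = 1 := by
  have hchar : ringChar (ZMod q) ≠ ringChar (ZMod p) := by
    rw [ZMod.ringChar_zmod_n, ZMod.ringChar_zmod_n]; exact hpq.symm
  let ψ := AddChar.FiniteField.primitiveChar (ZMod p) (ZMod q) hchar
  let K := CyclotomicField ψ.n (ZMod q)
  have : CharP K q := charP_of_injective_algebraMap (algebraMap (ZMod q) K).injective q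
  let Θ : GaussianInt →+* K := (algebraMap (ZMod q) K).comp θ
  set χ' : MulChar (ZMod p) K := χ.ringHomComp Θ with hχ'
  have h4 : χ' ^ 4 = 1 := by
    rw [hχ', MulChar.ringHomComp_pow, mulChar_pow_four, MulChar.ringHomComp_one]
  have hK2 : (-1 : K) ≠ 1 := by
    have : Fact (2 < q) := ⟨by have := (Fact.out : q.Prime).two_le; omega⟩
    simpa using (algebraMap (ZMod q) K).injective.ne (ZMod.neg_one_ne_one (n := q))
  have h2 : χ' ^ 2 ≠ 1 := by
    obtain ⟨a, ha⟩ := MulChar.ne_one_iff.mp (mulChar_sq_ne_one hp hχ)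
    refine MulChar.ne_one_iff.mpr ⟨a, ?_⟩
    have ha2 : (χ ^ 2) a ^ 2 = 1 := by
      rw [← MulChar.pow_apply_coe, ← pow_mul, mulChar_pow_four, MulChar.one_apply_coe]
    rw [hχ', MulChar.ringHomComp_pow, MulChar.ringHomComp_apply,
      (sq_eq_sq_iff_eq_or_eq_neg.mp (ha2.trans (one_pow 2).symm)).resolve_left ha, map_neg, map_one]
    exact hK2
  have h1 : χ' ≠ 1 := by
    intro h; rw [h, one_pow] at h2; exact h2 rfl
  have hqp : (q : ZMod p) ≠ 0 := by
    rw [Ne, ZMod.natCast_eq_zero_iff, Nat.prime_dvd_prime_iff_eq Fact.out Fact.out]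
    exact hpq
  have hpK : (Fintype.card (ZMod p) : K) ≠ 0 := by
    rw [ZMod.card, Ne, CharP.cast_eq_zero_iff K q, Nat.prime_dvd_prime_iff_eq Fact.out Fact.out]
    exact hpq.symm
  have hG := gaussSum_ne_zero_of_nontrivial hpK h1 ψ.prim
  have hfrob := gaussSum_frob q χ' ψ.char
  have hχq : χ' ^ q = χ' := by
    have hq4 : χ' ^ (4 * (q / 4) + 1) = χ' := by
      rw [pow_succ, pow_mul, h4, one_pow, one_mul]
    rwa [show 4 * (q / 4) + 1 = q by omega] at hq4
  have hshift := gaussSum_mulShift χ' ψ.char (Units.mk0 _ hqp)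
  rw [hχq, AddChar.pow_mulShift] at hfrob
  rw [Units.val_mk0, ← hfrob] at hshift
  have hG4 := gaussSum_pow_four h2 h4 ψ.prim
  have hpow : gaussSum χ' ψ.char ^ q =
      (gaussSum χ' ψ.char ^ 4) ^ ((q - 1) / 4) * gaussSum χ' ψ.char := by
    rw [← pow_mul, ← pow_succ]
    congr 1
    omega
  rw [hpow, hG4, ← mul_assoc] at hshift
  replace hshift := mul_right_cancel₀ hG (hshift.trans (one_mul _).symm)
  rw [mul_pow, ← pow_mul, show 2 * ((q - 1) / 4) = q / 2 by omega, hχ', jacobiSum_ringHomComp,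
    ZMod.card] at hshift
  have hJ : Θ (jacobiSum χ χ) ^ (q / 2) = Θ π ^ (q / 2) := by
    rcases jacobiSum_eq_or_neg hp hχ hπ him hφ with h | h
    · rw [h]
    · rw [h, map_neg, Even.neg_pow (by rw [Nat.even_iff]; omega)]
  rw [hJ] at hshift
  refine (algebraMap (ZMod q) K).injective ?_
  simpa [Θ] using hshift

theorem eq_intCast_of_map_eq (hp : p ≠ 2) {u : GaussianInt} (hu : u.norm = 1) {t : ℤ}
    (ht : t = 1 ∨ t = -1) (h : φ u = t) : u = t := by
  have : Fact (2 < p) := ⟨by have := (Fact.out : p.Prime).two_le; omega⟩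
  have hne : (-1 : ZMod p) ≠ 1 := ZMod.neg_one_ne_one
  have hI : φ I ^ 2 = -1 := by rw [← map_pow, I_sq, map_neg, map_one]
  have ht2 : (t : ZMod p) ^ 2 = 1 := by rcases ht with rfl | rfl <;> simp
  rw [← h] at ht2
  rcases eq_unit_of_norm_eq_one hu with rfl | rfl | rfl | rfl
  · rcases ht with rfl | rfl
    · simp
    · simp [hne.symm] at h
  · rcases ht with rfl | rfl
    · simp [hne] at h
    · simp
  · exact absurd (hI.symm.trans ht2) hne
  · rw [map_neg, neg_sq] at ht2
    exact absurd (hI.symm.trans ht2) hne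

theorem map_one_add_I_ne_zero (hp : p ≠ 2) (φ : GaussianInt →+* ZMod p) : φ ⟨1, 1⟩ ≠ 0 := by
  intro h
  have h2 : (2 : ZMod p) = 0 := by
    have : (2 : GaussianInt) = -I * ⟨1, 1⟩ ^ 2 := by decide
    rw [← map_ofNat φ 2, this, map_mul, map_pow, h]
    simp
  have h2' : ((2 : ℕ) : ZMod p) = 0 := by exact_mod_cast h2
  rw [ZMod.natCast_eq_zero_iff, Nat.prime_dvd_prime_iff_eq Fact.out Nat.prime_two] at h2'
  exact hp h2'

/-- The quartic symbol of `2`, in terms of the quadratic symbol of `1 + i`. -/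
theorem two_pow_eq (hp : p % 4 = 1) (φ : GaussianInt →+* ZMod p) :
    (2 : ZMod p) ^ ((p - 1) / 4) = φ (-I) ^ ((p - 1) / 4) * φ ⟨1, 1⟩ ^ (p / 2) := by
  have : (2 : GaussianInt) = -I * ⟨1, 1⟩ ^ 2 := by decide
  rw [← map_ofNat φ 2, this, map_mul, mul_pow, map_pow, ← pow_mul]
  congr 2
  omega

end residue

end GaussianInt

theorem Int.eq_of_intCast_zmod_eq_of_sign {q : ℕ} (hq : 2 < q) {a b : ℤ} (ha : a = 1 ∨ a = -1)
    (hb : b = 1 ∨ b = -1) (h : (a : ZMod q) = b) : a = b := by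
  have : Fact (2 < q) := ⟨hq⟩
  have hne : (-1 : ZMod q) ≠ 1 := ZMod.neg_one_ne_one
  rcases ha with rfl | rfl <;> rcases hb with rfl | rfl
  · rfl
  · simp [hne.symm] at h
  · simp [hne] at h
  · rfl

/-- Let `p₁ ≡ p₂ ≡ 1 (mod 4)` be distinct primes with Legendre symbols
`(2/p₁) = (2/p₂) = (p₁/p₂)` (encoded by equivalences of residue conditions).  Write
`p₁ = e² + 4f²`, `p₂ = g² + 4h²`, `π₁ = e + 2if`, `π₃ = g + 2ih ∈ ℤ[i]`.  Then
`(p₁p₂/2)₄·(2p₁/p₂)₄·(2p₂/p₁)₄ = (π₁/π₃)·((1+i)/π₁)·((1+i)/π₃)`, where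
`(p₁p₂/2)₄ = (-1)^((p₁p₂-1)/8)`, `c = (2p₁/p₂)₄`, `d = (2p₂/p₁)₄` are quartic symbols and
`s₁ = (π₁/π₃)`, `s₂ = ((1+i)/π₁)`, `s₃ = ((1+i)/π₃)` are the quadratic residue symbols in
`ℤ[i]` (value `1` iff the element is a square in the residue field). -/
theorem stmt_15 (p₁ p₂ : ℕ) (hp₁ : p₁.Prime) (hp₂ : p₂.Prime) (hne : p₁ ≠ p₂)
    (hm₁ : p₁ % 4 = 1) (hm₂ : p₂ % 4 = 1)
    (hL₁ : IsSquare (2 : ZMod p₁) ↔ IsSquare (2 : ZMod p₂))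
    (hL₂ : IsSquare (2 : ZMod p₂) ↔ IsSquare ((p₁ : ZMod p₂)))
    (e f g h : ℤ) (hef : (p₁ : ℤ) = e ^ 2 + 4 * f ^ 2) (hgh : (p₂ : ℤ) = g ^ 2 + 4 * h ^ 2)
    (c d : ℤ) (hc : c = 1 ∨ c = -1) (hd : d = 1 ∨ d = -1)
    (hccong : (c : ZMod p₂) = ((2 * p₁ : ℕ) : ZMod p₂) ^ ((p₂ - 1) / 4))
    (hdcong : (d : ZMod p₁) = ((2 * p₂ : ℕ) : ZMod p₁) ^ ((p₁ - 1) / 4))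
    (s₁ s₂ s₃ : ℤ)
    (hs₁v : s₁ = 1 ∨ s₁ = -1) (hs₂v : s₂ = 1 ∨ s₂ = -1) (hs₃v : s₃ = 1 ∨ s₃ = -1)
    (hs₁ : s₁ = 1 ↔ IsSquare (Ideal.Quotient.mk (Ideal.span {(⟨g, 2 * h⟩ : GaussianInt)})
      (⟨e, 2 * f⟩ : GaussianInt)))
    (hs₂ : s₂ = 1 ↔ IsSquare (Ideal.Quotient.mk (Ideal.span {(⟨e, 2 * f⟩ : GaussianInt)})
      (⟨1, 1⟩ : GaussianInt)))
    (hs₃ : s₃ = 1 ↔ IsSquare (Ideal.Quotient.mk (Ideal.span {(⟨g, 2 * h⟩ : GaussianInt)})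
      (⟨1, 1⟩ : GaussianInt))) :
    (-1 : ℤ) ^ ((p₁ * p₂ - 1) / 8) * c * d = s₁ * s₂ * s₃ := by
  have : Fact p₁.Prime := ⟨hp₁⟩
  have : Fact p₂.Prime := ⟨hp₂⟩
  have h₁2 : p₁ ≠ 2 := by omega
  have h₂2 : p₂ ≠ 2 := by omega
  have h8 : p₁ % 8 = p₂ % 8 := by
    rw [ZMod.exists_sq_eq_two_iff h₁2, ZMod.exists_sq_eq_two_iff h₂2] at hL₁
    omega
  have hπ₁ : (⟨e, 2 * f⟩ : GaussianInt).norm = p₁ := by rw [hef, Zsqrtd.norm_def]; ring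
  have hπ₃ : (⟨g, 2 * h⟩ : GaussianInt).norm = p₂ := by rw [hgh, Zsqrtd.norm_def]; ring
  obtain ⟨φ, hφs, hφ⟩ := GaussianInt.exists_residueHom p₁ _ hπ₁
  obtain ⟨θ, hθs, hθ⟩ := GaussianInt.exists_residueHom p₂ _ hπ₃
  obtain ⟨χ, hχ⟩ := GaussianInt.exists_quartic_mulChar hm₁ φ
  rw [isSquare_quotient_mk_span_iff hθs hθ] at hs₁ hs₃
  rw [isSquare_quotient_mk_span_iff hφs hφ] at hs₂
  have hrec := GaussianInt.map_mulChar_mul_eq_one hm₁ hm₂ hne hχ hπ₁ (dvd_mul_right 2 f) hφ θ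
  have hθπ : θ ⟨e, 2 * f⟩ ≠ 0 := by
    intro h0
    rw [h0, zero_pow (show p₂ / 2 ≠ 0 by have := hp₂.two_le; omega), zero_mul, mul_zero] at hrec
    exact zero_ne_one hrec
  have hs₁' := ZMod.intCast_eq_pow_half_of_isSquare_iff hθπ hs₁v hs₁
  have hs₂' := ZMod.intCast_eq_pow_half_of_isSquare_iff
    (GaussianInt.map_one_add_I_ne_zero h₁2 φ) hs₂v hs₂
  have hs₃' := ZMod.intCast_eq_pow_half_of_isSquare_iff
    (GaussianInt.map_one_add_I_ne_zero h₂2 θ) hs₃v hs₃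
  have h₂₁ : (p₂ : ZMod p₁) ≠ 0 := by
    rwa [Ne, ZMod.natCast_eq_zero_iff, Nat.prime_dvd_prime_iff_eq hp₁ hp₂]
  have hs₂sq : s₂ * s₂ = 1 := by rcases hs₂v with rfl | rfl <;> rfl
  have hu : (-GaussianInt.I) ^ ((p₁ - 1) / 4) * χ p₂ = ((d * s₂ : ℤ) : GaussianInt) := by
    refine GaussianInt.eq_intCast_of_map_eq (φ := φ) h₁2 ?_ ?_ ?_
    · have hI : Zsqrtd.normMonoidHom (-GaussianInt.I) = 1 := by decide
      rw [Zsqrtd.norm_mul, GaussianInt.norm_mulChar_apply h₂₁, mul_one]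
      exact (map_pow Zsqrtd.normMonoidHom _ _).trans (by rw [hI, one_pow])
    · rcases hd with rfl | rfl <;> rcases hs₂v with rfl | rfl <;> simp
    · have hs₂sq' : (s₂ : ZMod p₁) * s₂ = 1 := by
        exact_mod_cast congrArg (Int.cast : ℤ → ZMod p₁) hs₂sq
      rw [map_mul, map_pow, hχ, Int.cast_mul, hdcong, Nat.cast_mul, mul_pow, Nat.cast_ofNat,
        GaussianInt.two_pow_eq hm₁ φ, ← hs₂']
      linear_combination
        -(φ (-GaussianInt.I) ^ ((p₁ - 1) / 4) * (p₂ : ZMod p₁) ^ ((p₁ - 1) / 4)) * hs₂sq'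
  replace hu := congrArg θ hu
  rw [map_mul, map_pow, map_intCast] at hu
  rw [Nat.cast_mul, mul_pow, Nat.cast_ofNat, GaussianInt.two_pow_eq hm₂ θ, ← hs₃'] at hccong
  rw [← hs₁'] at hrec
  have hI2 : θ (-GaussianInt.I) ^ 2 = -1 := by
    rw [← map_pow, neg_sq, GaussianInt.I_sq, map_neg, map_one]
  have hpow : θ (-GaussianInt.I) ^ ((p₁ - 1) / 4) * θ (-GaussianInt.I) ^ ((p₂ - 1) / 4) =
      (-1) ^ ((p₁ * p₂ - 1) / 8) := by
    rw [← pow_add, show (p₁ - 1) / 4 + (p₂ - 1) / 4 = 2 * ((p₁ + p₂ - 2) / 8) by omega,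
      pow_mul, hI2]
    refine neg_one_pow_congr ?_
    obtain ⟨a, r, rfl, hr⟩ : ∃ a r, p₁ = 8 * a + r ∧ (r = 1 ∨ r = 5) :=
      ⟨p₁ / 8, p₁ % 8, by omega, by omega⟩
    obtain ⟨b, rfl⟩ : ∃ b, p₂ = 8 * b + r := ⟨p₂ / 8, by omega⟩
    rw [Nat.even_iff, Nat.even_iff]
    rcases hr with rfl | rfl
    · rw [show (8 * a + 1) * (8 * b + 1) - 1 = 8 * (2 * (4 * (a * b)) + a + b) by
        rw [Nat.sub_eq_iff_eq_add (by nlinarith)]; ring]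
      omega
    · rw [show (8 * a + 5) * (8 * b + 5) - 1 = 8 * (2 * (4 * (a * b)) + 5 * a + 5 * b + 3) by
        rw [Nat.sub_eq_iff_eq_add (by nlinarith)]; ring]
      omega
  set ε : ℤ := (-1) ^ ((p₁ * p₂ - 1) / 8) with hε
  have hεv : ε = 1 ∨ ε = -1 := neg_one_pow_eq_or ℤ _
  have hεc : ((-1) ^ ((p₁ * p₂ - 1) / 8) : ZMod p₂) = (ε : ZMod p₂) := by
    rw [hε]; push_cast; rfl
  rw [hεc] at hpow
  have key : c * d * s₁ * s₂ = ε * s₃ := by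
    refine Int.eq_of_intCast_zmod_eq_of_sign (q := p₂) (by have := hp₂.two_le; omega) ?_ ?_ ?_
    · rcases hc with rfl | rfl <;> rcases hd with rfl | rfl <;> rcases hs₁v with rfl | rfl <;>
        rcases hs₂v with rfl | rfl <;> simp
    · rcases hεv with h | h <;> rcases hs₃v with rfl | rfl <;> simp [h]
    · push_cast at hu ⊢
      generalize θ (-GaussianInt.I) ^ ((p₁ - 1) / 4) = x at *
      generalize θ (-GaussianInt.I) ^ ((p₂ - 1) / 4) = y at *
      rw [hccong, ← hpow]
      linear_combination -(y * s₃ * (p₁ : ZMod p₂) ^ ((p₂ - 1) / 4) * s₁) * hu + x * y * s₃ * hrec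
  rcases hc with rfl | rfl <;> rcases hd with rfl | rfl <;> rcases hs₁v with rfl | rfl <;>
    rcases hs₂v with rfl | rfl <;> rcases hs₃v with rfl | rfl <;> omega
end
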